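/- arXiv:2301.03762 — 2 statements merged into one kernel-verified Lean document; each statement's English description precedes it below -/
import Mathlib

section
/- Let n ≥ 5 and let h = h_n be the Hessenberg function (2, n−1, …, n−1, n, n) on [n]. Then the ℚ-algebra R(h) is NOT generated by the images of the degree-2 elements of H(h) ⊗ ℚ; that is, the subalgebra of R(h) generated by these images is a proper subalgebra. -/
open MvPolynomial

/-- The GKM condition over `ℚ`: `f` belongs to the GKM ring `H(h) ⊗ ℚ` of the Hessenberg
function `h` (0-based indexing: position `j : Fin n` corresponds to `j+1 ∈ [n]`). -/
def InGKMQ {n : ℕ} (h : Fin n → Fin n)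
    (f : Equiv.Perm (Fin n) → MvPolynomial (Fin n) ℚ) : Prop :=
  ∀ (w : Equiv.Perm (Fin n)) (i j : Fin n), j < i → i ≤ h j →
    f w - f (w * Equiv.swap i j) ∈ Ideal.span {X (w i) - X (w j)}

/-- An element of the GKM ring has (cohomological) degree 2 when all of its values are
homogeneous polynomials of degree 1 (including the zero polynomial). -/
def DegTwoQ {n : ℕ} (f : Equiv.Perm (Fin n) → MvPolynomial (Fin n) ℚ) : Prop :=
  ∀ w, (f w).IsHomogeneous 1

/-- `R(h) = (H(h) ⊗ ℚ) / (t_1, …, t_n)` is generated by the images of the degree-2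
elements:  every `f ∈ H(h) ⊗ ℚ` is, modulo the ideal of `H(h) ⊗ ℚ` generated by the
constant functions `t_1, …, t_n`, a polynomial in degree-2 elements of `H(h) ⊗ ℚ`. -/
def GenInDegTwoQ {n : ℕ} (h : Fin n → Fin n) : Prop :=
  ∀ f : Equiv.Perm (Fin n) → MvPolynomial (Fin n) ℚ, InGKMQ h f →
    ∃ g ∈ Algebra.adjoin ℚ
        {f' : Equiv.Perm (Fin n) → MvPolynomial (Fin n) ℚ | InGKMQ h f' ∧ DegTwoQ f'},
      ∃ a : Fin n → Equiv.Perm (Fin n) → MvPolynomial (Fin n) ℚ,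
        (∀ i, InGKMQ h (a i)) ∧ f = g + ∑ i, a i * (fun _ => X i)

namespace HessNG

/-- The value-collapsing map sending `a` to `b`. -/
def coll {n : ℕ} (a b : Fin n) : Fin n → Fin n := fun x => if x = a then b else x

lemma sub_rename_dvd {n : ℕ} (a b : Fin n) (s : Fin n → Fin n)
    (hs : ∀ x, s x = x ∨ (x = a ∧ s x = b) ∨ (x = b ∧ s x = a)) (p : MvPolynomial (Fin n) ℚ) :
    (X a - X b) ∣ p - rename s p := by
  rw [← Ideal.mem_span_singleton, ← Ideal.Quotient.eq]
  have : (Ideal.Quotient.mkₐ ℚ (Ideal.span {(X a - X b : MvPolynomial (Fin n) ℚ)})) =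
      (Ideal.Quotient.mkₐ ℚ (Ideal.span {(X a - X b : MvPolynomial (Fin n) ℚ)})).comp
        (rename s) := by
    apply MvPolynomial.algHom_ext
    intro x
    simp only [AlgHom.comp_apply, rename_X, Ideal.Quotient.mkₐ_eq_mk]
    rw [Ideal.Quotient.eq, Ideal.mem_span_singleton]
    rcases hs x with h | ⟨h1, h2⟩ | ⟨h1, h2⟩
    · rw [h]; simp
    · rw [h2, h1]
    · rw [h2, h1]; exact ⟨-1, by ring⟩
  exact DFunLike.congr_fun this p

lemma dvd_iff_coll {n : ℕ} (a b : Fin n) (p : MvPolynomial (Fin n) ℚ) :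
    (X a - X b) ∣ p ↔ rename (coll a b) p = 0 := by
  constructor
  · rintro ⟨q, rfl⟩
    have : rename (coll a b) (X a - X b : MvPolynomial (Fin n) ℚ) = 0 := by
      simp only [map_sub, rename_X, coll]
      by_cases h : b = a <;> simp [h]
    rw [map_mul, this, zero_mul]
  · intro h
    have := sub_rename_dvd a b (coll a b) (by
      intro x; unfold coll; split_ifs with hx
      · right; left; exact ⟨hx, rfl⟩
      · left; rfl) p
    rwa [h, sub_zero] at this

lemma prime_sub {n : ℕ} {a b : Fin n} (hab : a ≠ b) :
    Prime (X a - X b : MvPolynomial (Fin n) ℚ) := by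
  refine ⟨?_, ?_, ?_⟩
  · rw [sub_ne_zero]
    exact fun h => hab (X_injective h)
  · intro h
    have h1 := isUnit_iff_dvd_one.1 h
    rw [dvd_iff_coll, map_one] at h1
    exact one_ne_zero h1
  · intro p q h
    rw [dvd_iff_coll, map_mul, mul_eq_zero] at h
    rw [dvd_iff_coll, dvd_iff_coll]
    exact h

lemma not_dvd_sub {n : ℕ} {a b c d : Fin n} (hab : a < b) (hcd : c < d)
    (hne : (a, b) ≠ (c, d)) :
    ¬ (X b - X a : MvPolynomial (Fin n) ℚ) ∣ X d - X c := by
  rw [dvd_iff_coll]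
  simp only [map_sub, rename_X, sub_eq_zero]
  intro h
  have h := X_injective h
  unfold coll at h
  simp only [ne_eq, Prod.mk.injEq, not_and] at hne
  split_ifs at h with h1 h2 h2
  · exact absurd (h1.trans h2.symm) hcd.ne'
  · exact hne h h1.symm
  · rw [h, h2] at hcd; exact absurd hcd (not_lt.2 hab.le)
  · exact hcd.ne' h

/-- All pairs `i < j`. -/
def pairs (n : ℕ) : Finset (Fin n × Fin n) := Finset.univ.filter (fun p => p.1 < p.2)

/-- The Vandermonde product. -/
noncomputable def Dl (n : ℕ) : MvPolynomial (Fin n) ℚ := ∏ p ∈ pairs n, (X p.2 - X p.1)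

lemma Dl_ne_zero (n : ℕ) : Dl n ≠ 0 := by
  unfold Dl
  rw [Finset.prod_ne_zero_iff]
  intro p hp
  simp only [pairs, Finset.mem_filter, Finset.mem_univ, true_and] at hp
  exact (prime_sub hp.ne').ne_zero

lemma Dl_dvd {n : ℕ} (N : MvPolynomial (Fin n) ℚ)
    (hN : ∀ a b : Fin n, a ≠ b → rename (coll a b) N = 0) : Dl n ∣ N := by
  unfold Dl
  apply Finset.prod_dvd_of_isRelPrime
  · intro p hp q hq hpq
    simp only [pairs, Finset.coe_filter, Finset.mem_univ, true_and, Set.mem_ofPred_eq] at hp hq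
    change IsRelPrime _ _
    rw [(prime_sub hp.ne').irreducible.isRelPrime_iff_not_dvd]
    exact not_dvd_sub hp hq hpq
  · intro p hp
    simp only [pairs, Finset.mem_filter, Finset.mem_univ, true_and] at hp
    rw [dvd_iff_coll]
    exact hN _ _ hp.ne'

lemma rename_Dl {n : ℕ} (w : Equiv.Perm (Fin n)) :
    rename w (Dl n) = ((Equiv.Perm.sign w : ℤ) : MvPolynomial (Fin n) ℚ) * Dl n := by
  have key : ∀ f : Fin n → Fin n → MvPolynomial (Fin n) ℚ,
      ∏ p ∈ pairs n, f p.1 p.2 = ∏ i, ∏ j ∈ Finset.Ioi i, f i j := by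
    intro f
    rw [pairs, Finset.prod_filter, Fintype.prod_prod_type]
    refine Finset.prod_congr rfl fun i _ => ?_
    rw [← Finset.prod_filter]
    refine Finset.prod_congr ?_ fun _ _ => rfl
    ext j; simp
  unfold Dl
  rw [map_prod, key (fun i j => X j - X i),
    ← w.prod_Ioi_comp_eq_sign_mul_prod (f := fun i j => X j - X i) (by intros; ring),
    ← key (fun i j => X (w j) - X (w i))]
  refine Finset.prod_congr rfl fun p _ => ?_
  simp

/-- Edges of the incomparability graph of `h_n`. -/
def Edge {n : ℕ} (i j : Fin n) : Prop :=
  i ≠ j ∧ ((i.val ≤ 1 ∧ j.val ≤ 1) ∨ (1 ≤ i.val ∧ i.val + 2 ≤ n ∧ 1 ≤ j.val ∧ j.val + 2 ≤ n) ∨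
    (n ≤ i.val + 2 ∧ n ≤ j.val + 2))

lemma Edge.symm {n : ℕ} {i j : Fin n} (h : Edge i j) : Edge j i := by
  unfold Edge at *
  refine ⟨h.1.symm, ?_⟩
  rcases h.2 with h | h | h
  · exact Or.inl ⟨h.2, h.1⟩
  · exact Or.inr (Or.inl ⟨h.2.2.1, h.2.2.2, h.1, h.2.1⟩)
  · exact Or.inr (Or.inr ⟨h.2, h.1⟩)

/-- The GKM condition written with `Edge`. -/
def GK {n : ℕ} (f : Equiv.Perm (Fin n) → MvPolynomial (Fin n) ℚ) : Prop :=
  ∀ (w : Equiv.Perm (Fin n)) (i j : Fin n), Edge i j →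
    (X (w i) - X (w j)) ∣ f w - f (w * Equiv.swap i j)

lemma gk_iff {n : ℕ} (hn : 5 ≤ n) (h : Fin n → Fin n)
    (hval : ∀ j : Fin n, (h j : ℕ) =
      if (j : ℕ) = 0 then 1 else if (j : ℕ) + 2 < n then n - 2 else n - 1)
    (f : Equiv.Perm (Fin n) → MvPolynomial (Fin n) ℚ) : InGKMQ h f ↔ GK f := by
  have hE : ∀ i j : Fin n, j < i → (Edge i j ↔ i ≤ h j) := by
    intro i j hij
    have h1 := hval j
    have h2 := i.isLt
    have h3 : j.val < i.val := hij
    unfold Edge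
    rw [Fin.le_def, ← Fin.val_ne_iff]
    split_ifs at h1 <;> omega
  constructor
  · intro H w i j hij
    rcases lt_or_gt_of_ne hij.1 with hlt | hlt
    · have := H w j i hlt ((hE _ _ hlt).1 hij.symm)
      rw [Ideal.mem_span_singleton, Equiv.swap_comm] at this
      rwa [← neg_sub, neg_dvd]
    · have := H w i j hlt ((hE _ _ hlt).1 hij)
      rwa [Ideal.mem_span_singleton] at this
  · intro H w i j hlt hij
    rw [Ideal.mem_span_singleton]
    exact H w i j ((hE _ _ hlt).2 hij)

/-- The ordered pairs used in the functional. -/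
def TT {n : ℕ} (p : Fin n × Fin n) : Prop :=
  (p.1.val = 0 ∧ p.2.val = 1) ∨ (p.1.val = 1 ∧ 3 ≤ p.2.val ∧ p.2.val + 3 ≤ n) ∨
    (p.1.val + 2 = n ∧ p.2.val + 1 = n)

instance {n : ℕ} : DecidablePred (TT (n := n)) := fun p => by unfold TT; infer_instance

/-- Product over the complementary pairs. -/
noncomputable def EE (n : ℕ) : MvPolynomial (Fin n) ℚ :=
  ∏ p ∈ (pairs n).filter (fun p => ¬ TT p), (X p.2 - X p.1)

/-- The functional. -/
noncomputable def NN {n : ℕ} (χ : Equiv.Perm (Fin n) → ℤ)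
    (f : Equiv.Perm (Fin n) → MvPolynomial (Fin n) ℚ) : MvPolynomial (Fin n) ℚ :=
  ∑ w : Equiv.Perm (Fin n),
    (((Equiv.Perm.sign w : ℤ) * χ w : ℤ) : MvPolynomial (Fin n) ℚ) * (f w * rename w (EE n))

lemma coll_swap {n : ℕ} (a b : Fin n) : coll a b ∘ Equiv.swap a b = coll a b := by
  funext x
  simp only [Function.comp, coll, Equiv.swap_apply_def]
  split_ifs <;> simp_all

lemma EE_dvd {n : ℕ} {i j : Fin n} (hij : i ≠ j) (h1 : ¬ TT (i, j)) (h2 : ¬ TT (j, i)) :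
    (X i - X j) ∣ EE n := by
  rcases lt_or_gt_of_ne hij with h | h
  · rw [← neg_sub, neg_dvd]
    exact Finset.dvd_prod_of_mem (fun p : Fin n × Fin n => (X p.2 - X p.1 : MvPolynomial (Fin n) ℚ))
      (a := (i, j)) (by simp [pairs, h, h1])
  · exact Finset.dvd_prod_of_mem (fun p : Fin n × Fin n => (X p.2 - X p.1 : MvPolynomial (Fin n) ℚ))
      (a := (j, i)) (by simp [pairs, h, h2])

lemma TT.edge {n : ℕ} (hn : 5 ≤ n) {i j : Fin n} (h : TT (i, j)) : Edge i j := by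
  unfold TT at h
  unfold Edge
  rw [← Fin.val_ne_iff]
  simp only at h
  omega

lemma Dl_dvd_NN {n : ℕ} (hn : 5 ≤ n) (χ : Equiv.Perm (Fin n) → ℤ)
    (hχ : ∀ w i j, TT (i, j) → χ (w * Equiv.swap i j) = χ w)
    (f : Equiv.Perm (Fin n) → MvPolynomial (Fin n) ℚ) (hf : GK f) : Dl n ∣ NN χ f := by
  apply Dl_dvd
  intro a b hab
  unfold NN
  rw [map_sum]
  set G : Equiv.Perm (Fin n) → MvPolynomial (Fin n) ℚ := fun w => rename (coll a b)
    ((((Equiv.Perm.sign w : ℤ) * χ w : ℤ) : MvPolynomial (Fin n) ℚ) * (f w * rename w (EE n)))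
    with hG
  change ∑ w, G w = 0
  have hanti : ∀ w, G (Equiv.swap a b * w) = - G w := by
    intro w
    have hEeq : rename (coll a b) (rename (Equiv.swap a b * w) (EE n)) =
        rename (coll a b) (rename w (EE n)) := by
      rw [rename_rename, rename_rename]
      congr 2
      rw [Equiv.Perm.coe_mul, ← Function.comp_assoc, coll_swap]
    have hsw : Equiv.swap a b * w = w * Equiv.swap (w⁻¹ a) (w⁻¹ b) := by
      rw [Equiv.mul_swap_eq_swap_mul]; simp
    have hij : w⁻¹ a ≠ w⁻¹ b := fun h => hab (w⁻¹.injective h)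
    by_cases hT : TT (w⁻¹ a, w⁻¹ b) ∨ TT (w⁻¹ b, w⁻¹ a)
    · have hedge : Edge (w⁻¹ a) (w⁻¹ b) := by
        rcases hT with h | h
        · exact h.edge hn
        · exact (h.edge hn).symm
      have hχ' : χ (Equiv.swap a b * w) = χ w := by
        rw [hsw]
        rcases hT with h | h
        · exact hχ _ _ _ h
        · rw [Equiv.swap_comm]; exact hχ _ _ _ h
      have hf' : rename (coll a b) (f (Equiv.swap a b * w)) = rename (coll a b) (f w) := by
        have := hf w _ _ hedge
        rw [← hsw] at this
        rw [← Equiv.Perm.mul_apply, ← Equiv.Perm.mul_apply, mul_inv_cancel, Equiv.Perm.one_apply, Equiv.Perm.one_apply] at this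
        rw [dvd_iff_coll, map_sub, sub_eq_zero] at this
        exact this.symm
      simp only [hG, map_mul, hEeq, hf', hχ', Equiv.Perm.sign_mul, Equiv.Perm.sign_swap hab]
      simp
    · push Not at hT
      have hz : rename (coll a b) (rename w (EE n)) = 0 := by
        rw [← dvd_iff_coll]
        have := map_dvd (rename w) (EE_dvd hij hT.1 hT.2)
        simpa using this
      simp only [hG, map_mul, hEeq, hz, mul_zero, neg_zero]
  have h1 : ∑ w, G w = - ∑ w, G w := by
    rw [← Finset.sum_neg_distrib, ← Equiv.sum_comp (Equiv.mulLeft (Equiv.swap a b)) G]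
    exact Finset.sum_congr rfl fun w _ => hanti w
  exact self_eq_neg.1 h1

/-- Twisted functions. -/
noncomputable def tw {n : ℕ} (p : Equiv.Perm (Fin n) → Prop) (F : MvPolynomial (Fin n) ℚ) :
    Equiv.Perm (Fin n) → MvPolynomial (Fin n) ℚ :=
  open Classical in fun w => if p w then rename w F else 0

lemma tw_pos {n : ℕ} {p : Equiv.Perm (Fin n) → Prop} (F : MvPolynomial (Fin n) ℚ)
    {w : Equiv.Perm (Fin n)} (h : p w) : tw p F w = rename w F := if_pos h

lemma tw_neg {n : ℕ} {p : Equiv.Perm (Fin n) → Prop} (F : MvPolynomial (Fin n) ℚ)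
    {w : Equiv.Perm (Fin n)} (h : ¬ p w) : tw p F w = 0 := if_neg h

lemma tw_mul {n : ℕ} (p q : Equiv.Perm (Fin n) → Prop) (F G : MvPolynomial (Fin n) ℚ) :
    tw p F * tw q G = tw (fun w => p w ∧ q w) (F * G) := by
  funext w
  simp only [tw, Pi.mul_apply]
  by_cases h1 : p w <;> by_cases h2 : q w <;> simp [h1, h2]

lemma gk_tw {n : ℕ} (p : Equiv.Perm (Fin n) → Prop) (F : MvPolynomial (Fin n) ℚ)
    (H : ∀ i j : Fin n, Edge i j → (∀ w, p (w * Equiv.swap i j) ↔ p w) ∨ (X i - X j) ∣ F) :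
    GK (tw p F) := by
  intro w i j hij
  have hws : ((w * Equiv.swap i j : Equiv.Perm (Fin n)) : Fin n → Fin n) =
      w ∘ Equiv.swap i j := rfl
  rcases H i j hij with h | h
  · by_cases hw : p w
    · rw [tw_pos F hw, tw_pos F ((h w).2 hw), hws, ← rename_rename, ← map_sub]
      have := map_dvd (rename w) (sub_rename_dvd i j (Equiv.swap i j) (by
        intro x
        rw [Equiv.swap_apply_def]
        split_ifs <;> simp_all) F)
      simpa using this
    · rw [tw_neg F hw, tw_neg F (fun h' => hw ((h w).1 h'))]; simp
  · have h1 : (X (w i) - X (w j)) ∣ rename w F := by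
      have := map_dvd (rename w) h
      simpa using this
    have h2 : (X (w i) - X (w j)) ∣ rename (w * Equiv.swap i j) F := by
      have := map_dvd (rename (w * Equiv.swap i j)) h
      simp only [map_sub, rename_X, Equiv.Perm.mul_apply, Equiv.swap_apply_left,
        Equiv.swap_apply_right] at this
      rwa [← neg_sub, neg_dvd]
    apply dvd_sub
    · simp only [tw]; split_ifs
      · exact h1
      · exact dvd_zero _
    · simp only [tw]; split_ifs
      · exact h2
      · exact dvd_zero _

lemma NN_tw_vanish {n : ℕ} (hn : 5 ≤ n) (χ : Equiv.Perm (Fin n) → ℤ)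
    (hχ : ∀ w i j, TT (i, j) → χ (w * Equiv.swap i j) = χ w)
    (p : Equiv.Perm (Fin n) → Prop) (F : MvPolynomial (Fin n) ℚ) (hf : GK (tw p F))
    (σ : Equiv.Perm (Fin n)) (hp : ∀ w, p (σ * w) ↔ p w)
    (hanti : ∀ w, p w → χ (σ * w) = - χ w) :
    ∃ Q, NN χ (tw p F) = Dl n * Q ∧ constantCoeff Q = 0 := by
  obtain ⟨Q, hQ⟩ := Dl_dvd_NN hn χ hχ _ hf
  refine ⟨Q, hQ, ?_⟩
  have hsq : ((Equiv.Perm.sign σ : ℤ) : MvPolynomial (Fin n) ℚ) *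
      ((Equiv.Perm.sign σ : ℤ) : MvPolynomial (Fin n) ℚ) = 1 := by
    rw [← Int.cast_mul, ← Units.val_mul, Int.units_mul_self]; simp
  have h1 : rename σ (NN χ (tw p F)) =
      - ((Equiv.Perm.sign σ : ℤ) : MvPolynomial (Fin n) ℚ) * NN χ (tw p F) := by
    unfold NN
    rw [map_sum, Finset.mul_sum, ← Equiv.sum_comp (Equiv.mulLeft σ)
      (fun w => - ((Equiv.Perm.sign σ : ℤ) : MvPolynomial (Fin n) ℚ) * _)]
    refine Finset.sum_congr rfl fun w _ => ?_
    simp only [Equiv.coe_mulLeft]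
    have hws : ((σ * w : Equiv.Perm (Fin n)) : Fin n → Fin n) = σ ∘ w := rfl
    by_cases hw : p w
    · rw [tw_pos F hw, tw_pos F ((hp w).2 hw), hanti w hw, hws, ← rename_rename, ← rename_rename, Equiv.Perm.sign_mul]
      simp only [map_mul, map_intCast]
      push_cast
      linear_combination (-(((Equiv.Perm.sign w : ℤ) : MvPolynomial (Fin n) ℚ) * (χ w : MvPolynomial (Fin n) ℚ) *
        (rename σ (rename w F) * rename σ (rename w (EE n))))) * hsq
    · rw [tw_neg F hw, tw_neg F (fun h' => hw ((hp w).1 h'))]; simp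
  rw [hQ, map_mul, rename_Dl] at h1
  have h2 : rename σ Q = - Q := by
    have h3 : ((Equiv.Perm.sign σ : ℤ) : MvPolynomial (Fin n) ℚ) ≠ 0 := left_ne_zero_of_mul_eq_one hsq
    apply mul_left_cancel₀ (mul_ne_zero h3 (Dl_ne_zero n))
    rw [h1]; ring
  have h4 := congrArg constantCoeff h2
  rw [constantCoeff_rename, map_neg] at h4
  exact self_eq_neg.1 h4

/-- Indicator. -/
def II {α : Type*} [DecidableEq α] (x y : α) : ℤ := if x = y then 1 else 0

lemma II_self {α : Type*} [DecidableEq α] (x : α) : II x x = 1 := if_pos rfl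
lemma II_ne {α : Type*} [DecidableEq α] {x y : α} (h : x ≠ y) : II x y = 0 := if_neg h

/-- The weight. -/
def chi {α : Type*} [DecidableEq α] (z0 z1 z2 z3 z4 c d b : α) : ℤ :=
  (II d z0 + II b z0 - II d z2 - II b z2) * (II d z1 + II b z1 - II d z3 - II b z3) *
    (II c z0 + II c z1 + II c z2 + II c z3 - II c z4)

lemma II_perm {α : Type*} [DecidableEq α] (σ : Equiv.Perm α) (x y : α) :
    II (σ x) y = II x (σ.symm y) := by
  unfold II
  simp only [Equiv.eq_symm_apply]

lemma chi_perm {α : Type*} [DecidableEq α] (σ : Equiv.Perm α) (z0 z1 z2 z3 z4 c d b : α) :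
    chi z0 z1 z2 z3 z4 (σ c) (σ d) (σ b) =
      chi (σ.symm z0) (σ.symm z1) (σ.symm z2) (σ.symm z3) (σ.symm z4) c d b := by
  simp only [chi, II_perm]

lemma chi_02 {α : Type*} [DecidableEq α] (z0 z1 z2 z3 z4 c d b : α) :
    chi z2 z1 z0 z3 z4 c d b = - chi z0 z1 z2 z3 z4 c d b := by
  unfold chi; ring

lemma chi_13 {α : Type*} [DecidableEq α] (z0 z1 z2 z3 z4 c d b : α) :
    chi z0 z3 z2 z1 z4 c d b = - chi z0 z1 z2 z3 z4 c d b := by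
  unfold chi; ring

lemma chi_flip {α : Type*} [DecidableEq α] (z0 z1 z2 z3 z4 c d b : α) :
    chi z1 z0 z3 z2 z4 c d b = chi z0 z1 z2 z3 z4 c d b := by
  unfold chi; ring

lemma chi_comm {α : Type*} [DecidableEq α] (z0 z1 z2 z3 z4 c d b : α) :
    chi z0 z1 z2 z3 z4 c b d = chi z0 z1 z2 z3 z4 c d b := by
  unfold chi; ring

lemma chi_mixed {α : Type*} [DecidableEq α] {z0 z1 z2 z3 z4 c d : α}
    (h12 : z1 ≠ z2) (h13 : z1 ≠ z3)
    (h14 : z1 ≠ z4) (h23 : z2 ≠ z3) (h24 : z2 ≠ z4) (h01 : z1 ≠ z0)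
    (hc0 : c ≠ z0) (hd0 : d ≠ z0) (hc1 : c ≠ z1) (hd1 : d ≠ z1) (hcd : c ≠ d) :
    chi z0 z1 z2 z4 z3 c d z1 = - chi z0 z1 z2 z3 z4 c d z1 := by
  unfold chi
  rw [II_ne hc0, II_ne hd0, II_ne hc1, II_ne hd1, II_ne h01, II_ne h12, II_ne h13, II_ne h14,
    II_self]
  by_cases hd : d = z2
  · subst hd
    rw [II_ne hcd, II_ne h23, II_ne h24]; ring
  · rw [II_ne hd]; ring

lemma chi_mixed_swap {α : Type*} [DecidableEq α] {z0 z1 z2 z3 z4 c d : α}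
    (h12 : z1 ≠ z2) (h13 : z1 ≠ z3)
    (h14 : z1 ≠ z4) (h23 : z2 ≠ z3) (h24 : z2 ≠ z4) (h01 : z1 ≠ z0)
    (h03 : z0 ≠ z3) (h04 : z0 ≠ z4)
    (hc0 : c ≠ z0) (hd0 : d ≠ z0) (hc1 : c ≠ z1) (hd1 : d ≠ z1) (hcd : c ≠ d) :
    chi z0 z1 z2 z3 z4 (Equiv.swap z3 z4 c) (Equiv.swap z3 z4 d) (Equiv.swap z3 z4 z1) =
      - chi z0 z1 z2 z3 z4 c d z1 := by
  rw [chi_perm, Equiv.symm_swap, Equiv.swap_apply_left, Equiv.swap_apply_right,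
    Equiv.swap_apply_of_ne_of_ne h03 h04, Equiv.swap_apply_of_ne_of_ne h13 h14,
    Equiv.swap_apply_of_ne_of_ne h23 h24]
  exact chi_mixed h12 h13 h14 h23 h24 h01 hc0 hd0 hc1 hd1 hcd

/-- Positions / values. -/
def ps (m k : ℕ) (hk : k < m + 5 := by omega) : Fin (m + 5) := ⟨k, hk⟩

lemma ps_ne {m k l : ℕ} {hk : k < m + 5} {hl : l < m + 5} (h : k ≠ l) : ps m k hk ≠ ps m l hl := by
  intro h'; exact h (congrArg Fin.val h')

/-- The weight as a function of a permutation. -/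
def chiw (m : ℕ) (w : Equiv.Perm (Fin (m + 5))) : ℤ :=
  chi (ps m 0) (ps m 1) (ps m 2) (ps m 3) (ps m 4) (w (ps m 2)) (w (ps m (m + 3))) (w (ps m (m + 4)))

lemma chiw_T (m : ℕ) (w : Equiv.Perm (Fin (m + 5))) (i j : Fin (m + 5)) (h : TT (i, j)) :
    chiw m (w * Equiv.swap i j) = chiw m w := by
  have hne : ∀ x y : Fin (m + 5), x.val ≠ y.val → x ≠ y := fun x y h h' => h (congrArg _ h')
  unfold chiw
  simp only [Equiv.Perm.mul_apply]
  simp only [TT] at h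
  rcases h with h | h | h
  · rw [Equiv.swap_apply_of_ne_of_ne (hne _ _ (by simp [ps]; omega)) (hne _ _ (by simp [ps]; omega)),
      Equiv.swap_apply_of_ne_of_ne (hne _ _ (by simp [ps]; omega)) (hne _ _ (by simp [ps]; omega)),
      Equiv.swap_apply_of_ne_of_ne (hne _ _ (by simp [ps]; omega)) (hne _ _ (by simp [ps]; omega))]
  · rw [Equiv.swap_apply_of_ne_of_ne (hne _ _ (by simp [ps]; omega)) (hne _ _ (by simp [ps]; omega)),
      Equiv.swap_apply_of_ne_of_ne (hne _ _ (by simp [ps]; omega)) (hne _ _ (by simp [ps]; omega)),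
      Equiv.swap_apply_of_ne_of_ne (hne _ _ (by simp [ps]; omega)) (hne _ _ (by simp [ps]; omega))]
  · have hi : i = ps m (m + 3) := Fin.ext (by simp [ps]; omega)
    have hj : j = ps m (m + 4) := Fin.ext (by simp [ps]; omega)
    rw [hi, hj, Equiv.swap_apply_left, Equiv.swap_apply_right,
      Equiv.swap_apply_of_ne_of_ne (ps_ne (by omega)) (ps_ne (by omega)), chi_comm]

/-- Support condition. -/
def pp (m : ℕ) (α β : Option (Fin (m + 5))) (w : Equiv.Perm (Fin (m + 5))) : Prop :=
  (∀ a ∈ α, w (ps m 0) = a) ∧ (∀ b ∈ β, w (ps m (m + 4)) = b)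

lemma chiw_mul (m : ℕ) (σ w : Equiv.Perm (Fin (m + 5))) : chiw m (σ * w) =
  chi (ps m 0) (ps m 1) (ps m 2) (ps m 3) (ps m 4) (σ (w (ps m 2))) (σ (w (ps m (m + 3))))
    (σ (w (ps m (m + 4)))) := rfl

lemma mixed_aux (m : ℕ) (z0 z1 z2 z3 : Fin (m + 5)) (w : Equiv.Perm (Fin (m + 5)))
    (h12 : z1 ≠ z2) (h13 : z1 ≠ z3) (h23 : z2 ≠ z3) (h01 : z1 ≠ z0) (h03 : z0 ≠ z3)
    (h04 : z0 ≠ ps m 4) (h14 : z1 ≠ ps m 4) (h24 : z2 ≠ ps m 4)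
    (hw0 : w (ps m 0) = z0) (hw1 : w (ps m (m + 4)) = z1) :
    chi z0 z1 z2 z3 (ps m 4) (Equiv.swap z3 (ps m 4) (w (ps m 2)))
      (Equiv.swap z3 (ps m 4) (w (ps m (m + 3)))) (Equiv.swap z3 (ps m 4) (w (ps m (m + 4)))) =
    - chi z0 z1 z2 z3 (ps m 4) (w (ps m 2)) (w (ps m (m + 3))) (w (ps m (m + 4))) := by
  have hinj : ∀ k l (hk : k < m + 5) (hl : l < m + 5), k ≠ l → w (ps m k hk) ≠ w (ps m l hl) :=
    fun k l hk hl h h' => ps_ne h (w.injective h')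
  rw [hw1]
  apply chi_mixed_swap h12 h13 h14 h23 h24 h01 h03 h04
  · rw [← hw0]; apply hinj; omega
  · rw [← hw0]; apply hinj; omega
  · rw [← hw1]; apply hinj; omega
  · rw [← hw1]; apply hinj; omega
  · apply hinj; omega

lemma exists_sigma (m : ℕ) (α β : Option (Fin (m + 5))) :
    ∃ σ : Equiv.Perm (Fin (m + 5)), (∀ a ∈ α, σ a = a) ∧ (∀ b ∈ β, σ b = b) ∧
      ∀ w, pp m α β w → chiw m (σ * w) = - chiw m w := by
  have n01 : ps m 0 ≠ ps m 1 := ps_ne (by omega)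
  have n02 : ps m 0 ≠ ps m 2 := ps_ne (by omega)
  have n03 : ps m 0 ≠ ps m 3 := ps_ne (by omega)
  have n04 : ps m 0 ≠ ps m 4 := ps_ne (by omega)
  have n12 : ps m 1 ≠ ps m 2 := ps_ne (by omega)
  have n13 : ps m 1 ≠ ps m 3 := ps_ne (by omega)
  have n14 : ps m 1 ≠ ps m 4 := ps_ne (by omega)
  have n23 : ps m 2 ≠ ps m 3 := ps_ne (by omega)
  have n24 : ps m 2 ≠ ps m 4 := ps_ne (by omega)
  have n34 : ps m 3 ≠ ps m 4 := ps_ne (by omega)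
  have s02 : ∀ w, chiw m (Equiv.swap (ps m 0) (ps m 2) * w) = - chiw m w := by
    intro w
    rw [chiw_mul, chi_perm, Equiv.symm_swap, Equiv.swap_apply_left, Equiv.swap_apply_right,
      Equiv.swap_apply_of_ne_of_ne n01.symm n12, Equiv.swap_apply_of_ne_of_ne n03.symm n23.symm,
      Equiv.swap_apply_of_ne_of_ne n04.symm n24.symm, chi_02]
    rfl
  have s13 : ∀ w, chiw m (Equiv.swap (ps m 1) (ps m 3) * w) = - chiw m w := by
    intro w
    rw [chiw_mul, chi_perm, Equiv.symm_swap, Equiv.swap_apply_left, Equiv.swap_apply_right,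
      Equiv.swap_apply_of_ne_of_ne n01 n03, Equiv.swap_apply_of_ne_of_ne n12.symm n23,
      Equiv.swap_apply_of_ne_of_ne n14.symm n34.symm, chi_13]
    rfl
  by_cases hA : (ps m 0 ∉ α ∧ ps m 0 ∉ β) ∧ (ps m 2 ∉ α ∧ ps m 2 ∉ β)
  · refine ⟨Equiv.swap (ps m 0) (ps m 2), ?_, ?_, fun w _ => s02 w⟩
    · intro a ha
      exact Equiv.swap_apply_of_ne_of_ne (fun h => hA.1.1 (h ▸ ha)) (fun h => hA.2.1 (h ▸ ha))
    · intro a ha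
      exact Equiv.swap_apply_of_ne_of_ne (fun h => hA.1.2 (h ▸ ha)) (fun h => hA.2.2 (h ▸ ha))
  by_cases hB : (ps m 1 ∉ α ∧ ps m 1 ∉ β) ∧ (ps m 3 ∉ α ∧ ps m 3 ∉ β)
  · refine ⟨Equiv.swap (ps m 1) (ps m 3), ?_, ?_, fun w _ => s13 w⟩
    · intro a ha
      exact Equiv.swap_apply_of_ne_of_ne (fun h => hB.1.1 (h ▸ ha)) (fun h => hB.2.1 (h ▸ ha))
    · intro a ha
      exact Equiv.swap_apply_of_ne_of_ne (fun h => hB.1.2 (h ▸ ha)) (fun h => hB.2.2 (h ▸ ha))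
  have key : ∀ z0 z1 z2 z3 : Fin (m + 5), z1 ≠ z2 → z1 ≠ z3 → z2 ≠ z3 → z1 ≠ z0 → z0 ≠ z3 →
      z0 ≠ ps m 4 → z1 ≠ ps m 4 → z2 ≠ ps m 4 → α = some z0 → β = some z1 →
      (∀ c d b, chi (ps m 0) (ps m 1) (ps m 2) (ps m 3) (ps m 4) c d b =
          chi z0 z1 z2 z3 (ps m 4) c d b ∨ False) ∨
      (∀ c d b, chi (ps m 0) (ps m 1) (ps m 2) (ps m 3) (ps m 4) c d b =
          - chi z0 z1 z2 z3 (ps m 4) c d b) →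
      ∃ σ : Equiv.Perm (Fin (m + 5)), (∀ a ∈ α, σ a = a) ∧ (∀ b ∈ β, σ b = b) ∧
      ∀ w, pp m α β w → chiw m (σ * w) = - chiw m w := by
    intro z0 z1 z2 z3 h12 h13 h23 h10 h03 h04 h14 h24 hα hβ hchi
    subst hα hβ
    refine ⟨Equiv.swap z3 (ps m 4), ?_, ?_, ?_⟩
    · intro a ha
      obtain rfl := Option.some_inj.1 ha
      exact Equiv.swap_apply_of_ne_of_ne h03 h04
    · intro a ha
      obtain rfl := Option.some_inj.1 ha
      exact Equiv.swap_apply_of_ne_of_ne h13 h14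
    · intro w hw
      have := mixed_aux m z0 z1 z2 z3 w h12 h13 h23 h10 h03 h04 h14 h24 (hw.1 _ rfl) (hw.2 _ rfl)
      rw [chiw_mul]
      unfold chiw
      rcases hchi with hchi | hchi
      · simp only [or_false] at hchi
        rw [hchi, hchi, this]
      · rw [hchi, hchi, this]
  have hA' : (α = some (ps m 0) ∨ α = some (ps m 2)) ∨ (β = some (ps m 0) ∨ β = some (ps m 2)) := by
    simp only [Option.mem_def] at hA; tauto
  have hB' : (α = some (ps m 1) ∨ α = some (ps m 3)) ∨ (β = some (ps m 1) ∨ β = some (ps m 3)) := by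
    simp only [Option.mem_def] at hB; tauto
  rcases hA' with (h | h) | (h | h) <;> rcases hB' with (h' | h') | (h' | h')
  · exact absurd (Option.some_inj.1 (h.symm.trans h')) n01
  · exact absurd (Option.some_inj.1 (h.symm.trans h')) n03
  · exact key (ps m 0) (ps m 1) (ps m 2) (ps m 3) n12 n13 n23 n01.symm n03 n04 n14 n24 h h'
      (Or.inl fun c d b => Or.inl rfl)
  · exact key (ps m 0) (ps m 3) (ps m 2) (ps m 1) n23.symm n13.symm n12.symm n03.symm n01 n04 n34 n24
      h h' (Or.inr fun c d b => by unfold chi; ring)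
  · exact absurd (Option.some_inj.1 (h.symm.trans h')) n12.symm
  · exact absurd (Option.some_inj.1 (h.symm.trans h')) n23
  · exact key (ps m 2) (ps m 1) (ps m 0) (ps m 3) n01.symm n13 n03 n12 n23 n24 n14 n04
      h h' (Or.inr fun c d b => by unfold chi; ring)
  · exact key (ps m 2) (ps m 3) (ps m 0) (ps m 1) n03.symm n13.symm n01 n23.symm n12.symm n24 n34 n04
      h h' (Or.inl fun c d b => Or.inl (by unfold chi; ring))
  · exact key (ps m 1) (ps m 0) (ps m 3) (ps m 2) n03 n02 n23.symm n01 n12 n14 n04 n34 h' h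
      (Or.inl fun c d b => Or.inl (by unfold chi; ring))
  · exact key (ps m 3) (ps m 0) (ps m 1) (ps m 2) n01 n02 n12 n03 n23.symm n34 n04 n14 h' h
      (Or.inr fun c d b => by unfold chi; ring)
  · exact absurd (Option.some_inj.1 (h.symm.trans h')) n01
  · exact absurd (Option.some_inj.1 (h.symm.trans h')) n03
  · exact key (ps m 1) (ps m 2) (ps m 3) (ps m 0) n23 n02.symm n03.symm n12.symm n01.symm n14 n24 n34
      h' h (Or.inr fun c d b => by unfold chi; ring)
  · exact key (ps m 3) (ps m 2) (ps m 1) (ps m 0) n12.symm n02.symm n01.symm n23 n03.symm n34 n24 n14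
      h' h (Or.inl fun c d b => Or.inl (by unfold chi; ring))
  · exact absurd (Option.some_inj.1 (h.symm.trans h')) n12.symm
  · exact absurd (Option.some_inj.1 (h.symm.trans h')) n23

/-- First edge factor. -/
noncomputable def e1 (m : ℕ) : Option (Fin (m + 5)) → MvPolynomial (Fin (m + 5)) ℚ
  | none => 1
  | some _ => X (ps m 0) - X (ps m 1)

/-- Last edge factor. -/
noncomputable def e2 (m : ℕ) : Option (Fin (m + 5)) → MvPolynomial (Fin (m + 5)) ℚ
  | none => 1
  | some _ => X (ps m (m + 3)) - X (ps m (m + 4))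

/-- The span of the special family. -/
noncomputable def SS (m : ℕ) : Submodule (MvPolynomial (Fin (m + 5)) ℚ)
    (Equiv.Perm (Fin (m + 5)) → MvPolynomial (Fin (m + 5)) ℚ) :=
  Submodule.span _ {f | ∃ α β F, f = tw (pp m α β) (e1 m α * e2 m β * F)}

lemma gk_gen (m : ℕ) (α β : Option (Fin (m + 5))) (F : MvPolynomial (Fin (m + 5)) ℚ) :
    GK (tw (pp m α β) (e1 m α * e2 m β * F)) := by
  have hne : ∀ x y : Fin (m + 5), x.val ≠ y.val → x ≠ y := fun x y h h' => h (congrArg _ h')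
  apply gk_tw
  intro i j hij
  by_cases h1 : i.val ≤ 1 ∧ j.val ≤ 1
  · cases α with
    | none =>
      left
      intro w
      unfold pp
      have : Equiv.swap i j (ps m (m + 4)) = ps m (m + 4) :=
        Equiv.swap_apply_of_ne_of_ne (hne _ _ (by simp [ps]; omega)) (hne _ _ (by simp [ps]; omega))
      simp [this]
    | some a =>
      right
      apply Dvd.dvd.mul_right
      apply Dvd.dvd.mul_right
      have hv := Fin.val_ne_iff.2 hij.1
      by_cases hi : i.val = 0
      · have hi' : i = ps m 0 := Fin.ext hi
        have hj' : j = ps m 1 := Fin.ext (by simp [ps]; omega)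
        rw [hi', hj']; exact dvd_rfl
      · have hi' : i = ps m 1 := Fin.ext (by simp [ps]; omega)
        have hj' : j = ps m 0 := Fin.ext (show j.val = 0 by omega)
        rw [hi', hj', ← neg_sub, neg_dvd]; exact dvd_rfl
  by_cases h2 : m + 3 ≤ i.val ∧ m + 3 ≤ j.val
  · cases β with
    | none =>
      left
      intro w
      unfold pp
      have : Equiv.swap i j (ps m 0) = ps m 0 :=
        Equiv.swap_apply_of_ne_of_ne (hne _ _ (by simp [ps]; omega)) (hne _ _ (by simp [ps]; omega))
      simp [this]
    | some a =>
      right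
      apply Dvd.dvd.mul_right
      apply Dvd.dvd.mul_left
      have hv := Fin.val_ne_iff.2 hij.1
      have := i.isLt
      have := j.isLt
      by_cases hi : i.val = m + 3
      · have hi' : i = ps m (m + 3) := Fin.ext hi
        have hj' : j = ps m (m + 4) := Fin.ext (by simp [ps]; omega)
        rw [hi', hj']; exact dvd_rfl
      · have hi' : i = ps m (m + 4) := Fin.ext (by simp [ps]; omega)
        have hj' : j = ps m (m + 3) := Fin.ext (by simp [ps]; omega)
        rw [hi', hj', ← neg_sub, neg_dvd]; exact dvd_rfl
  · left
    intro w
    have hE := hij.2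
    unfold pp
    have t1 : Equiv.swap i j (ps m 0) = ps m 0 :=
      Equiv.swap_apply_of_ne_of_ne (hne _ _ (by simp [ps]; omega)) (hne _ _ (by simp [ps]; omega))
    have t2 : Equiv.swap i j (ps m (m + 4)) = ps m (m + 4) :=
      Equiv.swap_apply_of_ne_of_ne (hne _ _ (by simp [ps]; omega)) (hne _ _ (by simp [ps]; omega))
    simp [t1, t2]

lemma NN_add {n : ℕ} (χ : Equiv.Perm (Fin n) → ℤ)
    (f g : Equiv.Perm (Fin n) → MvPolynomial (Fin n) ℚ) : NN χ (f + g) = NN χ f + NN χ g := by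
  unfold NN
  rw [← Finset.sum_add_distrib]
  refine Finset.sum_congr rfl fun w _ => ?_
  rw [Pi.add_apply]; ring

lemma NN_smul {n : ℕ} (χ : Equiv.Perm (Fin n) → ℤ) (c : MvPolynomial (Fin n) ℚ)
    (f : Equiv.Perm (Fin n) → MvPolynomial (Fin n) ℚ) : NN χ (c • f) = c * NN χ f := by
  unfold NN
  rw [Finset.mul_sum]
  refine Finset.sum_congr rfl fun w _ => ?_
  rw [Pi.smul_apply, smul_eq_mul]; ring

/-- The property that `NN f` is `Dl` times something with zero constant term. -/
def Van (m : ℕ) (f : Equiv.Perm (Fin (m + 5)) → MvPolynomial (Fin (m + 5)) ℚ) : Prop :=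
  ∃ Q, NN (chiw m) f = Dl (m + 5) * Q ∧ constantCoeff Q = 0

lemma Van.add {m : ℕ} {f g : Equiv.Perm (Fin (m + 5)) → MvPolynomial (Fin (m + 5)) ℚ}
    (hf : Van m f) (hg : Van m g) : Van m (f + g) := by
  obtain ⟨Q, h1, h2⟩ := hf
  obtain ⟨Q', h1', h2'⟩ := hg
  refine ⟨Q + Q', ?_, ?_⟩
  · rw [NN_add, h1, h1']; ring
  · rw [map_add, h2, h2', add_zero]

lemma Van.zero (m : ℕ) : Van m 0 := by
  refine ⟨0, ?_, map_zero _⟩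
  simp [NN]

lemma Van.smul {m : ℕ} {f : Equiv.Perm (Fin (m + 5)) → MvPolynomial (Fin (m + 5)) ℚ}
    (c : MvPolynomial (Fin (m + 5)) ℚ) (hf : Van m f) : Van m (c • f) := by
  obtain ⟨Q, h1, h2⟩ := hf
  refine ⟨c * Q, ?_, ?_⟩
  · rw [NN_smul, h1]; ring
  · rw [map_mul, h2, mul_zero]

lemma Van.sum {m : ℕ} {ι : Type*} (s : Finset ι)
    (f : ι → Equiv.Perm (Fin (m + 5)) → MvPolynomial (Fin (m + 5)) ℚ)
    (hf : ∀ i ∈ s, Van m (f i)) : Van m (∑ i ∈ s, f i) :=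
  Finset.sum_induction _ _ (fun _ _ => Van.add) (Van.zero m) hf

lemma Van.mul_X {m : ℕ} {f : Equiv.Perm (Fin (m + 5)) → MvPolynomial (Fin (m + 5)) ℚ}
    (hf : GK f) (i : Fin (m + 5)) : Van m (f * fun _ => X i) := by
  obtain ⟨Q, hQ⟩ := Dl_dvd_NN (by omega) (chiw m) (chiw_T m) f hf
  refine ⟨X i * Q, ?_, ?_⟩
  · have : (f * fun _ => X i) = (X i : MvPolynomial (Fin (m + 5)) ℚ) • f := by
      funext w; simp [mul_comm]
    rw [this, NN_smul, hQ]; ring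
  · simp

lemma Van.of_SS {m : ℕ} {f : Equiv.Perm (Fin (m + 5)) → MvPolynomial (Fin (m + 5)) ℚ}
    (hf : f ∈ SS m) : Van m f := by
  induction hf using Submodule.span_induction with
  | mem f hf =>
    obtain ⟨α, β, F, rfl⟩ := hf
    obtain ⟨σ, h1, h2, h3⟩ := exists_sigma m α β
    refine NN_tw_vanish (by omega) (chiw m) (chiw_T m) _ _ (gk_gen m α β F) σ ?_ h3
    intro w
    unfold pp
    simp only [Equiv.Perm.mul_apply]
    refine and_congr (forall_congr' fun a => forall_congr' fun ha => ?_)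
      (forall_congr' fun a => forall_congr' fun ha => ?_)
    · nth_rw 1 [← h1 a ha]; exact σ.injective.eq_iff
    · nth_rw 1 [← h2 a ha]; exact σ.injective.eq_iff
  | zero => exact Van.zero m
  | add f g _ _ hf hg => exact hf.add hg
  | smul c f _ hf => exact hf.smul c

lemma SS_gen (m : ℕ) (α β : Option (Fin (m + 5))) (p : Equiv.Perm (Fin (m + 5)) → Prop)
    (hp : ∀ w, p w ↔ pp m α β w) (F G : MvPolynomial (Fin (m + 5)) ℚ)
    (hF : F = e1 m α * e2 m β * G) : tw p F ∈ SS m := by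
  apply Submodule.subset_span
  refine ⟨α, β, G, ?_⟩
  have : p = pp m α β := funext fun w => propext (hp w)
  rw [this, hF]

lemma SS_scalar (m : ℕ) (c : MvPolynomial (Fin (m + 5)) ℚ) : (fun _ => c) ∈ SS m := by
  have h : (fun _ => c) = c • tw (pp m none none) (1 : MvPolynomial (Fin (m + 5)) ℚ) := by
    funext w
    rw [Pi.smul_apply, tw_pos _ (by simp [pp])]; simp
  rw [h]
  exact Submodule.smul_mem _ _ (SS_gen m none none _ (fun _ => Iff.rfl) _ 1 (by simp [e1, e2]))

lemma merge1 {V : Type*} (α α' : Option V) {R : Type*} [CommRing R] (e : Option V → R) (x : R)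
    (hn : e none = 1) (hs : ∀ a, e (some a) = x) :
    (∃ γ G, e α * e α' = e γ * G ∧ ∀ v : V, ((∀ a ∈ α, v = a) ∧ (∀ a ∈ α', v = a)) ↔ ∀ a ∈ γ, v = a) ∨
    (∀ v : V, ¬ ((∀ a ∈ α, v = a) ∧ (∀ a ∈ α', v = a))) := by
  classical
  cases α with
  | none => exact Or.inl ⟨α', 1, by rw [hn, one_mul, mul_one], by simp⟩
  | some a =>
    cases α' with
    | none => exact Or.inl ⟨some a, 1, by rw [hn], by simp⟩
    | some b =>
      by_cases h : a = b
      · subst h; exact Or.inl ⟨some a, x, by simp only [hs], by simp⟩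
      · right; rintro v ⟨h1, h2⟩
        exact h ((h1 a rfl).symm.trans (h2 b rfl))

lemma SS_mul {m : ℕ} {f g : Equiv.Perm (Fin (m + 5)) → MvPolynomial (Fin (m + 5)) ℚ}
    (hf : f ∈ SS m) (hg : g ∈ SS m) : f * g ∈ SS m := by
  induction hf using Submodule.span_induction with
  | zero => rw [zero_mul]; exact Submodule.zero_mem _
  | add f f' _ _ hf hf' => rw [add_mul]; exact Submodule.add_mem _ hf hf'
  | smul c f _ hf => rw [smul_mul_assoc]; exact Submodule.smul_mem _ _ hf
  | mem f hf =>
    induction hg using Submodule.span_induction with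
    | zero => rw [mul_zero]; exact Submodule.zero_mem _
    | add f f' _ _ hf hf' => rw [mul_add]; exact Submodule.add_mem _ hf hf'
    | smul c f _ hf => rw [mul_smul_comm]; exact Submodule.smul_mem _ _ hf
    | mem g hg =>
      obtain ⟨α, β, F, rfl⟩ := hf
      obtain ⟨α', β', F', rfl⟩ := hg
      rw [tw_mul]
      have hzero : ∀ (p : Equiv.Perm (Fin (m + 5)) → Prop) (F : MvPolynomial (Fin (m + 5)) ℚ),
          (∀ w, ¬ p w) → tw p F ∈ SS m := by
        intro p F hp
        have : tw p F = 0 := funext fun w => tw_neg F (hp w)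
        rw [this]; exact Submodule.zero_mem _
      rcases merge1 α α' (e1 m) _ rfl (fun _ => rfl) with ⟨γ, G, h1, h2⟩ | h1
      · rcases merge1 β β' (e2 m) _ rfl (fun _ => rfl) with ⟨δ, G', h3, h4⟩ | h3
        · refine SS_gen m γ δ _ ?_ _ (G * G' * F * F') ?_
          · intro w
            unfold pp
            rw [← h2, ← h4]; tauto
          · linear_combination F * F' * e2 m β * e2 m β' * h1 + F * F' * e1 m γ * G * h3
        · exact hzero _ _ fun w hw => h3 (w (ps m (m + 4))) ⟨hw.1.2, hw.2.2⟩
      · exact hzero _ _ fun w hw => h1 (w (ps m 0)) ⟨hw.1.1, hw.2.1⟩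

lemma adjoin_SS {m : ℕ} (S : Set (Equiv.Perm (Fin (m + 5)) → MvPolynomial (Fin (m + 5)) ℚ))
    (hS : ∀ f ∈ S, f ∈ SS m) {g} (hg : g ∈ Algebra.adjoin ℚ S) : g ∈ SS m := by
  induction hg using Algebra.adjoin_induction with
  | mem f hf => exact hS f hf
  | algebraMap r => exact SS_scalar m (C r)
  | add f g _ _ hf hg => exact Submodule.add_mem _ hf hg
  | mul f g _ _ hf hg => exact SS_mul hf hg

/-- Middle positions. -/
def JJ (m : ℕ) : Finset (Fin (m + 5)) := Finset.univ.filter (fun i => 3 ≤ i.val ∧ i.val ≤ m + 2)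

/-- The product over the middle positions. -/
noncomputable def PJ (m : ℕ) : MvPolynomial (Fin (m + 5)) ℚ := ∏ i ∈ JJ m, (X i - X (ps m 1))

/-- The quadratic factor. -/
noncomputable def qA (m : ℕ) : MvPolynomial (Fin (m + 5)) ℚ :=
  (X (ps m 1) - X (ps m 2)) * (X (ps m 1) - X (ps m (m + 3)))

/-- The edge factor. -/
noncomputable def eA (m : ℕ) : MvPolynomial (Fin (m + 5)) ℚ :=
  (X (ps m 1) - X (ps m 0)) * (X (ps m (m + 4)) - X (ps m (m + 3)))

/-- The support of the class. -/
def pA (m : ℕ) (w : Equiv.Perm (Fin (m + 5))) : Prop :=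
  (w (ps m 0) = ps m 0 ∧ w (ps m 1) = ps m 1) ∨ (w (ps m 0) = ps m 1 ∧ w (ps m 1) = ps m 0)

lemma sub_dvd_F0 (m : ℕ) (k : Fin (m + 5)) (h1 : 2 ≤ k.val) (h2 : k.val ≤ m + 3) :
    (X (ps m 1) - X k) ∣ qA m * PJ m := by
  by_cases h3 : k.val = 2
  · have : k = ps m 2 := Fin.ext h3
    rw [this]
    exact Dvd.dvd.mul_right (Dvd.intro _ rfl) _
  by_cases h4 : k.val = m + 3
  · have : k = ps m (m + 3) := Fin.ext h4
    rw [this]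
    exact Dvd.dvd.mul_right (Dvd.intro_left _ rfl) _
  · apply Dvd.dvd.mul_left
    rw [← neg_sub, neg_dvd]
    exact Finset.dvd_prod_of_mem (fun i : Fin (m + 5) => (X i - X (ps m 1) : MvPolynomial (Fin (m + 5)) ℚ))
      (by simp [JJ]; omega)

lemma gk_fA (m : ℕ) : GK (tw (pA m) (qA m * PJ m)) := by
  have hne : ∀ x y : Fin (m + 5), x.val ≠ y.val → x ≠ y := fun x y h h' => h (congrArg _ h')
  apply gk_tw
  intro i j hij
  have hv := Fin.val_ne_iff.2 hij.1
  have hE := hij.2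
  by_cases h1 : i.val ≤ 1 ∧ j.val ≤ 1
  · left
    intro w
    have hs : Equiv.swap i j = Equiv.swap (ps m 0) (ps m 1) := by
      by_cases hi : i.val = 0
      · have hi' : i = ps m 0 := Fin.ext hi
        have hj' : j = ps m 1 := Fin.ext (show j.val = 1 by omega)
        rw [hi', hj']
      · have hi' : i = ps m 1 := Fin.ext (show i.val = 1 by omega)
        have hj' : j = ps m 0 := Fin.ext (show j.val = 0 by omega)
        rw [hi', hj', Equiv.swap_comm]
    rw [hs]
    unfold pA
    simp only [Equiv.Perm.mul_apply, Equiv.swap_apply_left, Equiv.swap_apply_right]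
    tauto
  by_cases h2 : i.val = 1
  · right
    have hi' : i = ps m 1 := Fin.ext h2
    rw [hi']
    exact sub_dvd_F0 m j (by omega) (by omega)
  by_cases h3 : j.val = 1
  · right
    have hj' : j = ps m 1 := Fin.ext h3
    rw [hj', ← neg_sub, neg_dvd]
    exact sub_dvd_F0 m i (by omega) (by omega)
  · left
    intro w
    have t1 : Equiv.swap i j (ps m 0) = ps m 0 :=
      Equiv.swap_apply_of_ne_of_ne (hne _ _ (by change 0 ≠ i.val; omega)) (hne _ _ (by change 0 ≠ j.val; omega))
    have t2 : Equiv.swap i j (ps m 1) = ps m 1 :=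
      Equiv.swap_apply_of_ne_of_ne (hne _ _ (by change 1 ≠ i.val; omega)) (hne _ _ (by change 1 ≠ j.val; omega))
    unfold pA
    simp only [Equiv.Perm.mul_apply, t1, t2]

lemma EE_mul (m : ℕ) : eA m * PJ m * EE (m + 5) = Dl (m + 5) := by
  unfold EE Dl
  rw [← Finset.prod_filter_mul_prod_filter_not (pairs (m + 5)) TT]
  congr 1
  have hset : (pairs (m + 5)).filter TT = insert (ps m 0, ps m 1)
      (insert (ps m (m + 3), ps m (m + 4)) ((JJ m).image (fun i => (ps m 1, i)))) := by
    ext ⟨i, j⟩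
    simp only [pairs, TT, JJ, ps, Finset.mem_filter, Finset.mem_univ, true_and, Finset.mem_insert,
      Finset.mem_image, Prod.mk.injEq, Fin.ext_iff, Fin.lt_def]
    constructor
    · rintro ⟨h, h' | h' | h'⟩
      · left; omega
      · right; right; exact ⟨j, by omega, by omega, rfl⟩
      · right; left; omega
    · rintro (h | h | ⟨k, hk, h1, h2⟩) <;> omega
  rw [hset, Finset.prod_insert, Finset.prod_insert, Finset.prod_image]
  · unfold eA PJ; ring
  · intro a _ b _ h; exact (Prod.mk.inj h).2
  · simp only [JJ, ps, Finset.mem_filter, Finset.mem_univ, true_and, 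
      Finset.mem_image, Prod.mk.injEq, Fin.ext_iff]
    rintro ⟨k, hk, h1, h2⟩; omega
  · simp only [JJ, ps, Finset.mem_filter, Finset.mem_univ, true_and, Finset.mem_insert,
      Finset.mem_image, Prod.mk.injEq, Fin.ext_iff]
    rintro (h | ⟨k, hk, h1, h2⟩) <;> omega

/-- The swap of the first two positions. -/
abbrev sA (m : ℕ) : Equiv.Perm (Fin (m + 5)) := Equiv.swap (ps m 0) (ps m 1)
/-- The swap of the last two positions. -/
abbrev tA (m : ℕ) : Equiv.Perm (Fin (m + 5)) := Equiv.swap (ps m (m + 3)) (ps m (m + 4))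

lemma altsum (m : ℕ) (P : MvPolynomial (Fin (m + 5)) ℚ) (hP : P = qA m * PJ m * EE (m + 5)) :
    P - rename (sA m) P - rename (tA m) P + rename (sA m) (rename (tA m) P) = Dl (m + 5) := by
  have n01 : ps m 0 ≠ ps m 1 := ps_ne (by omega)
  have n34 : ps m (m + 3) ≠ ps m (m + 4) := ps_ne (by omega)
  have he : eA m ≠ 0 := by
    unfold eA
    refine mul_ne_zero (sub_ne_zero.2 ?_) (sub_ne_zero.2 ?_)
    · exact fun h => n01 (X_injective h).symm
    · exact fun h => n34 (X_injective h).symm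
  have hs0 : sA m (ps m 0) = ps m 1 := Equiv.swap_apply_left _ _
  have hs1 : sA m (ps m 1) = ps m 0 := Equiv.swap_apply_right _ _
  have hs2 : sA m (ps m 2) = ps m 2 := Equiv.swap_apply_of_ne_of_ne (ps_ne (by omega)) (ps_ne (by omega))
  have hs3 : sA m (ps m (m + 3)) = ps m (m + 3) := Equiv.swap_apply_of_ne_of_ne (ps_ne (by omega)) (ps_ne (by omega))
  have hs4 : sA m (ps m (m + 4)) = ps m (m + 4) := Equiv.swap_apply_of_ne_of_ne (ps_ne (by omega)) (ps_ne (by omega))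
  have ht3 : tA m (ps m (m + 3)) = ps m (m + 4) := Equiv.swap_apply_left _ _
  have ht4 : tA m (ps m (m + 4)) = ps m (m + 3) := Equiv.swap_apply_right _ _
  have ht0 : tA m (ps m 0) = ps m 0 := Equiv.swap_apply_of_ne_of_ne (ps_ne (by omega)) (ps_ne (by omega))
  have ht1 : tA m (ps m 1) = ps m 1 := Equiv.swap_apply_of_ne_of_ne (ps_ne (by omega)) (ps_ne (by omega))
  have ht2 : tA m (ps m 2) = ps m 2 := Equiv.swap_apply_of_ne_of_ne (ps_ne (by omega)) (ps_ne (by omega))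
  have h1 : eA m * P = Dl (m + 5) * qA m := by rw [hP, ← EE_mul]; ring
  have hDs : rename (sA m) (Dl (m + 5)) = - Dl (m + 5) := by
    rw [rename_Dl, Equiv.Perm.sign_swap n01]; simp
  have hDt : rename (tA m) (Dl (m + 5)) = - Dl (m + 5) := by
    rw [rename_Dl, Equiv.Perm.sign_swap n34]; simp
  have hes : rename (sA m) (eA m) = - eA m := by
    unfold eA
    simp only [map_mul, map_sub, rename_X, hs0, hs1, hs3, hs4]; ring
  have het : rename (tA m) (eA m) = - eA m := by
    unfold eA
    simp only [map_mul, map_sub, rename_X, ht0, ht1, ht3, ht4]; ring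
  have h2 : eA m * rename (sA m) P = Dl (m + 5) * rename (sA m) (qA m) := by
    have := congrArg (rename (sA m)) h1
    rw [map_mul, map_mul, hDs, hes] at this
    linear_combination - this
  have h3 : eA m * rename (tA m) P = Dl (m + 5) * rename (tA m) (qA m) := by
    have := congrArg (rename (tA m)) h1
    rw [map_mul, map_mul, hDt, het] at this
    linear_combination - this
  have h4 : eA m * rename (sA m) (rename (tA m) P) =
      Dl (m + 5) * rename (sA m) (rename (tA m) (qA m)) := by
    have := congrArg (rename (sA m)) h3
    rw [map_mul, map_mul, hDs, hes] at this
    linear_combination - this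
  have hq : qA m - rename (sA m) (qA m) - rename (tA m) (qA m) +
      rename (sA m) (rename (tA m) (qA m)) = eA m := by
    unfold qA eA
    simp only [map_mul, map_sub, rename_X, hs1, hs2, hs3, hs4, ht1, ht2, ht3]
    ring
  apply mul_left_cancel₀ he
  linear_combination h1 - h2 - h3 + h4 + Dl (m + 5) * hq

/-- Alternating sum functional. -/
noncomputable def LL {n : ℕ} (c : Equiv.Perm (Fin n) → ℤ) (P : MvPolynomial (Fin n) ℚ) :
    MvPolynomial (Fin n) ℚ :=
  ∑ w : Equiv.Perm (Fin n), (((Equiv.Perm.sign w : ℤ) * c w : ℤ) : MvPolynomial (Fin n) ℚ) * rename w P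

lemma LL_add {n : ℕ} (c : Equiv.Perm (Fin n) → ℤ) (P Q : MvPolynomial (Fin n) ℚ) :
    LL c (P + Q) = LL c P + LL c Q := by
  unfold LL
  rw [← Finset.sum_add_distrib]
  refine Finset.sum_congr rfl fun w _ => ?_
  rw [map_add]; ring

lemma LL_sub {n : ℕ} (c : Equiv.Perm (Fin n) → ℤ) (P Q : MvPolynomial (Fin n) ℚ) :
    LL c (P - Q) = LL c P - LL c Q := by
  unfold LL
  rw [← Finset.sum_sub_distrib]
  refine Finset.sum_congr rfl fun w _ => ?_
  rw [map_sub]; ring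

lemma LL_swap {n : ℕ} (c : Equiv.Perm (Fin n) → ℤ) (P : MvPolynomial (Fin n) ℚ) (i j : Fin n)
    (hij : i ≠ j) (hc : ∀ w, c (w * Equiv.swap i j) = c w) :
    LL c (rename (Equiv.swap i j) P) = - LL c P := by
  unfold LL
  rw [← Finset.sum_neg_distrib, ← Equiv.sum_comp (Equiv.mulRight (Equiv.swap i j)) (fun w => - _)]
  refine Finset.sum_congr rfl fun w _ => ?_
  rw [Equiv.coe_mulRight, hc, Equiv.Perm.sign_mul, Equiv.Perm.sign_swap hij, rename_rename]
  have : ((w * Equiv.swap i j : Equiv.Perm (Fin n)) : Fin n → Fin n) = w ∘ Equiv.swap i j := rfl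
  rw [this]
  simp

lemma LL_Dl {n : ℕ} (c : Equiv.Perm (Fin n) → ℤ) :
    LL c (Dl n) = ((∑ w, c w : ℤ) : MvPolynomial (Fin n) ℚ) * Dl n := by
  unfold LL
  rw [Int.cast_sum, Finset.sum_mul]
  refine Finset.sum_congr rfl fun w _ => ?_
  have hsq : ((Equiv.Perm.sign w : ℤ) : MvPolynomial (Fin n) ℚ) *
      ((Equiv.Perm.sign w : ℤ) : MvPolynomial (Fin n) ℚ) = 1 := by
    rw [← Int.cast_mul, ← Units.val_mul, Int.units_mul_self]; simp
  rw [rename_Dl]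
  push_cast
  linear_combination (c w : MvPolynomial (Fin n) ℚ) * Dl n * hsq

/-- The restricted weight. -/
noncomputable def cA (m : ℕ) (w : Equiv.Perm (Fin (m + 5))) : ℤ :=
  open Classical in if pA m w then chiw m w else 0

lemma NN_fA (m : ℕ) : NN (chiw m) (tw (pA m) (qA m * PJ m)) = LL (cA m) (qA m * PJ m * EE (m + 5)) := by
  unfold NN LL
  refine Finset.sum_congr rfl fun w _ => ?_
  by_cases h : pA m w
  · rw [tw_pos _ h, cA, if_pos h]; simp only [map_mul]
  · rw [tw_neg _ h, cA, if_neg h]; simp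

lemma cA_s (m : ℕ) (w : Equiv.Perm (Fin (m + 5))) : cA m (w * sA m) = cA m w := by
  have hT : TT (ps m 0, ps m 1) := Or.inl ⟨rfl, rfl⟩
  have : pA m (w * sA m) ↔ pA m w := by
    unfold pA
    simp only [Equiv.Perm.mul_apply, Equiv.swap_apply_left, Equiv.swap_apply_right]
    tauto
  simp only [cA, chiw_T m w _ _ hT]
  by_cases h : pA m w
  · rw [if_pos h, if_pos (this.2 h)]
  · rw [if_neg h, if_neg (fun h2 => h (this.1 h2))]

lemma cA_t (m : ℕ) (w : Equiv.Perm (Fin (m + 5))) : cA m (w * tA m) = cA m w := by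
  have hT : TT (ps m (m + 3), ps m (m + 4)) := Or.inr (Or.inr ⟨rfl, rfl⟩)
  have ht0 : tA m (ps m 0) = ps m 0 := Equiv.swap_apply_of_ne_of_ne (ps_ne (by omega)) (ps_ne (by omega))
  have ht1 : tA m (ps m 1) = ps m 1 := Equiv.swap_apply_of_ne_of_ne (ps_ne (by omega)) (ps_ne (by omega))
  have : pA m (w * tA m) ↔ pA m w := by
    unfold pA
    simp only [Equiv.Perm.mul_apply, ht0, ht1]
  simp only [cA, chiw_T m w _ _ hT]
  by_cases h : pA m w
  · rw [if_pos h, if_pos (this.2 h)]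
  · rw [if_neg h, if_neg (fun h2 => h (this.1 h2))]

lemma four_NN (m : ℕ) : 4 * NN (chiw m) (tw (pA m) (qA m * PJ m)) =
    ((∑ w, cA m w : ℤ) : MvPolynomial (Fin (m + 5)) ℚ) * Dl (m + 5) := by
  rw [NN_fA, ← LL_Dl, ← altsum m _ rfl]
  set P := qA m * PJ m * EE (m + 5)
  rw [LL_add, LL_sub, LL_sub, LL_swap _ _ _ _ (ps_ne (by omega)) (cA_s m),
    LL_swap _ _ _ _ (ps_ne (by omega)) (cA_t m), LL_swap _ _ _ _ (ps_ne (by omega)) (cA_s m),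
    LL_swap _ _ _ _ (ps_ne (by omega)) (cA_t m)]
  ring

lemma II_nonneg {α : Type*} [DecidableEq α] (x y : α) : 0 ≤ II x y := by
  unfold II; split_ifs <;> simp

lemma chi_le {α : Type*} [DecidableEq α] {z0 z1 z2 z3 z4 c d b : α}
    (hc0 : c ≠ z0) (hd0 : d ≠ z0) (hb0 : b ≠ z0) (hc1 : c ≠ z1) (hd1 : d ≠ z1) (hb1 : b ≠ z1)
    (hcd : c ≠ d) (hcb : c ≠ b) : chi z0 z1 z2 z3 z4 c d b ≤ 0 := by
  unfold chi
  rw [II_ne hc0, II_ne hd0, II_ne hb0, II_ne hc1, II_ne hd1, II_ne hb1]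
  by_cases h2 : c = z2
  · subst h2
    rw [II_ne hcd.symm, II_ne hcb.symm]; simp
  by_cases h3 : c = z3
  · subst h3
    rw [II_ne hcd.symm, II_ne hcb.symm]; simp
  rw [II_ne h2, II_ne h3]
  have := mul_nonneg (mul_nonneg (add_nonneg (II_nonneg d z2) (II_nonneg b z2))
    (add_nonneg (II_nonneg d z3) (II_nonneg b z3))) (II_nonneg c z4)
  linarith

lemma cA_le (m : ℕ) (w : Equiv.Perm (Fin (m + 5))) : cA m w ≤ 0 := by
  unfold cA
  split_ifs with h
  · have hinj : ∀ k l (hk : k < m + 5) (hl : l < m + 5), k ≠ l → w (ps m k hk) ≠ w (ps m l hl) :=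
      fun k l hk hl h h' => ps_ne h (w.injective h')
    have h01 : ∀ k (hk : k < m + 5), 2 ≤ k → w (ps m k hk) ≠ ps m 0 ∧ w (ps m k hk) ≠ ps m 1 := by
      intro k hk h2
      rcases h with ⟨h, h'⟩ | ⟨h, h'⟩
      · exact ⟨fun e => hinj _ _ _ _ (by omega) (e.trans h.symm),
          fun e => hinj _ _ _ _ (by omega) (e.trans h'.symm)⟩
      · exact ⟨fun e => hinj _ _ _ _ (by omega) (e.trans h'.symm),
          fun e => hinj _ _ _ _ (by omega) (e.trans h.symm)⟩
    exact chi_le (h01 _ _ (by omega)).1 (h01 _ _ (by omega)).1 (h01 _ _ (by omega)).1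
      (h01 _ _ (by omega)).2 (h01 _ _ (by omega)).2 (h01 _ _ (by omega)).2
      (hinj _ _ _ _ (by omega)) (hinj _ _ _ _ (by omega))
  · exact le_rfl

lemma perm_step {V : Type*} [DecidableEq V] (w : Equiv.Perm V) (i v : V) :
    ∃ w' : Equiv.Perm V, w' i = v ∧ ∀ j, j ≠ i → w j ≠ v → w' j = w j := by
  refine ⟨Equiv.swap (w i) v * w, by simp, fun j h1 h2 => ?_⟩
  rw [Equiv.Perm.mul_apply, Equiv.swap_apply_of_ne_of_ne (fun h => h1 (w.injective h)) h2]

lemma cA_witness (m : ℕ) : ∃ w, cA m w < 0 := by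
  obtain ⟨w1, h1, h1'⟩ := perm_step 1 (ps m 2) (ps m 4)
  obtain ⟨w2, h2, h2'⟩ := perm_step w1 (ps m (m + 3)) (ps m 2)
  obtain ⟨w3, h3, h3'⟩ := perm_step w2 (ps m (m + 4)) (ps m 3)
  have a0 : w1 (ps m 0) = ps m 0 := h1' _ (ps_ne (by omega)) (ps_ne (by omega))
  have a1 : w1 (ps m 1) = ps m 1 := h1' _ (ps_ne (by omega)) (ps_ne (by omega))
  have b0 : w2 (ps m 0) = ps m 0 := by
    rw [h2' _ (ps_ne (by omega)) (by rw [a0]; exact ps_ne (by omega)), a0]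
  have b1 : w2 (ps m 1) = ps m 1 := by
    rw [h2' _ (ps_ne (by omega)) (by rw [a1]; exact ps_ne (by omega)), a1]
  have b2 : w2 (ps m 2) = ps m 4 := by
    rw [h2' _ (ps_ne (by omega)) (by rw [h1]; exact ps_ne (by omega)), h1]
  have c0 : w3 (ps m 0) = ps m 0 := by
    rw [h3' _ (ps_ne (by omega)) (by rw [b0]; exact ps_ne (by omega)), b0]
  have c1 : w3 (ps m 1) = ps m 1 := by
    rw [h3' _ (ps_ne (by omega)) (by rw [b1]; exact ps_ne (by omega)), b1]
  have c2 : w3 (ps m 2) = ps m 4 := by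
    rw [h3' _ (ps_ne (by omega)) (by rw [b2]; exact ps_ne (by omega)), b2]
  have c3 : w3 (ps m (m + 3)) = ps m 2 := by
    rw [h3' _ (ps_ne (by omega)) (by rw [h2]; exact ps_ne (by omega)), h2]
  refine ⟨w3, ?_⟩
  have hp : pA m w3 := Or.inl ⟨c0, c1⟩
  rw [cA, if_pos hp, chiw, c2, c3, h3]
  simp [chi, II, ps]

lemma not_van (m : ℕ) : ¬ Van m (tw (pA m) (qA m * PJ m)) := by
  rintro ⟨Q, h1, h2⟩
  have h := four_NN m
  have h3 : (∑ w, cA m w) < 0 := by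
    obtain ⟨w, hw⟩ := cA_witness m
    exact Finset.sum_neg' (fun w _ => cA_le m w) ⟨w, Finset.mem_univ _, hw⟩
  set c : ℤ := ∑ w, cA m w
  rw [h1] at h
  have h4 : 4 * Q = (c : MvPolynomial (Fin (m + 5)) ℚ) := by
    apply mul_left_cancel₀ (Dl_ne_zero (m + 5))
    linear_combination h
  have h5 := congrArg constantCoeff h4
  rw [map_mul, h2, mul_zero, map_intCast] at h5
  have : c = 0 := by exact_mod_cast h5.symm
  omega

lemma lin_form {n : ℕ} (p : MvPolynomial (Fin n) ℚ) (hp : p.IsHomogeneous 1) :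
    ∃ c : Fin n → ℚ, p = ∑ s, C (c s) * X s := by
  have h : p ∈ homogeneousSubmodule (Fin n) ℚ 1 := hp
  rw [homogeneousSubmodule_one_eq_span_X] at h
  obtain ⟨c, hc⟩ := (Submodule.mem_span_range_iff_exists_fun ℚ).1 h
  refine ⟨c, ?_⟩
  rw [← hc]
  refine Finset.sum_congr rfl fun s _ => ?_
  rw [smul_eq_C_mul]

lemma mem_of_swaps {n : ℕ} (U : Subgroup (Equiv.Perm (Fin n))) (J : Fin n → Prop)
    (hU : ∀ a b, J a → J b → a ≠ b → Equiv.swap a b ∈ U) :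
    ∀ (k : ℕ) (u : Equiv.Perm (Fin n)), u.support.card ≤ k → (∀ x, ¬ J x → u x = x) → u ∈ U := by
  intro k
  induction k with
  | zero =>
    intro u hu _
    have : u = 1 := by
      rw [← Equiv.Perm.support_eq_empty_iff]
      exact Finset.card_eq_zero.1 (by omega)
    rw [this]; exact U.one_mem
  | succ k ih =>
    intro u hu hfix
    by_cases h1 : u = 1
    · rw [h1]; exact U.one_mem
    obtain ⟨x, hx⟩ : ∃ x, u x ≠ x := by
      by_contra hcon
      push Not at hcon
      exact h1 (Equiv.ext hcon)
    have hJx : J x := by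
      by_contra h; exact hx (hfix x h)
    have hJux : J (u x) := by
      by_contra h; exact hx (u.injective (hfix _ h))
    have hs := hU x (u x) hJx hJux hx.symm
    have h2 : Equiv.swap x (u x) * u ∈ U := by
      apply ih
      · have := Equiv.Perm.card_support_swap_mul hx
        omega
      · intro y hy
        rw [Equiv.Perm.mul_apply, hfix y hy, Equiv.swap_apply_of_ne_of_ne]
        · rintro rfl; exact hy hJx
        · rintro rfl; exact hy hJux
    have := U.mul_mem hs h2
    rwa [← mul_assoc, Equiv.swap_mul_self, one_mul] at this

lemma swap_trans_mem {n : ℕ} (U : Subgroup (Equiv.Perm (Fin n))) {a h b : Fin n}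
    (h1 : Equiv.swap a h ∈ U) (h2 : Equiv.swap b h ∈ U) (hab : a ≠ b) (hah : a ≠ h) (hbh : b ≠ h) :
    Equiv.swap a b ∈ U := by
  have : Equiv.swap a b = Equiv.swap a h * Equiv.swap b h * Equiv.swap a h := by
    have e := Equiv.swap_mul_swap_mul_swap (x := b) (y := h) (z := a) hbh hab.symm
    rw [← e, Equiv.swap_comm a h]
  rw [this]
  exact U.mul_mem (U.mul_mem h1 h2) h1

lemma mem_of_hub {n : ℕ} (U : Subgroup (Equiv.Perm (Fin n))) (J : Fin n → Prop) (h : Fin n)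
    (hU : ∀ a, J a → a ≠ h → Equiv.swap a h ∈ U) (u : Equiv.Perm (Fin n))
    (hfix : ∀ x, ¬ J x → u x = x) : u ∈ U := by
  refine mem_of_swaps U J ?_ _ u le_rfl hfix
  intro a b ha hb hab
  by_cases h1 : a = h
  · subst h1
    rw [Equiv.swap_comm]; exact hU b hb hab.symm
  by_cases h2 : b = h
  · subst h2; exact hU a ha hab
  exact swap_trans_mem U (hU a ha h1) (hU b hb h2) hab h1 h2

/-- Combinatorial form of the degree two GKM conditions. -/
structure Cls (m : ℕ) (F : Equiv.Perm (Fin (m + 5)) → Fin (m + 5) → ℚ) : Prop where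
  A : ∀ w i j, Edge i j → ∀ k, k ≠ i → k ≠ j → F (w * Equiv.swap i j) k = F w k
  B : ∀ w i j, Edge i j →
    F (w * Equiv.swap i j) i + F (w * Equiv.swap i j) j = F w i + F w j

/-- The stabilizer subgroup. -/
def UU {m : ℕ} (F : Equiv.Perm (Fin (m + 5)) → Fin (m + 5) → ℚ) (i : Fin (m + 5)) :
    Subgroup (Equiv.Perm (Fin (m + 5))) where
  carrier := {u | ∀ w, F (w * u) i = F w i}
  mul_mem' := by
    intro a b ha hb w
    rw [← mul_assoc, hb, ha]
  one_mem' := by intro w; rw [mul_one]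
  inv_mem' := by
    intro a ha w
    have := ha (w * a⁻¹)
    rw [inv_mul_cancel_right] at this
    exact this.symm

lemma Cls.dep {m : ℕ} {F : Equiv.Perm (Fin (m + 5)) → Fin (m + 5) → ℚ} (hF : Cls m F)
    (i h : Fin (m + 5)) (J : Fin (m + 5) → Prop)
    (hh : ∀ a, J a → a ≠ h → Equiv.swap a h ∈ UU F i) (w w' : Equiv.Perm (Fin (m + 5)))
    (hw : ∀ x, ¬ J x → w x = w' x) : F w i = F w' i := by
  have := mem_of_hub (UU F i) J h hh (w⁻¹ * w') (by
    intro x hx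
    rw [Equiv.Perm.mul_apply, ← hw x hx, ← Equiv.Perm.mul_apply, inv_mul_cancel, Equiv.Perm.one_apply])
  have := this w
  rw [mul_inv_cancel_left] at this
  exact this.symm

lemma Cls.dep_gen {m : ℕ} {F : Equiv.Perm (Fin (m + 5)) → Fin (m + 5) → ℚ} (hF : Cls m F)
    (i : Fin (m + 5)) (h1 : i ≠ ps m 1) (h2 : i ≠ ps m (m + 3)) (w w' : Equiv.Perm (Fin (m + 5)))
    (hw : w i = w' i) : F w i = F w' i := by
  have h1' : i.val ≠ 1 := fun h => h1 (Fin.ext h)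
  have h2' : i.val ≠ m + 3 := fun h => h2 (Fin.ext h)
  have hsw : ∀ a b : Fin (m + 5), a ≠ i → b ≠ i → Edge a b → Equiv.swap a b ∈ UU F i :=
    fun a b ha hb hab w => hF.A w a b hab i ha.symm hb.symm
  refine hF.dep i (ps m 1) (fun x => x ≠ i) ?_ w w' (fun x hx => by rw [not_not.1 hx, hw])
  intro a ha ha1
  have hav : a.val ≠ 1 := fun h => ha1 (Fin.ext h)
  have hlt := a.isLt
  by_cases h4 : a.val = m + 4
  · refine swap_trans_mem (h := ps m (m + 3)) _ ?_ ?_ ha1 ?_ (ps_ne (by omega))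
    · refine hsw _ _ ha h2.symm ⟨?_, Or.inr (Or.inr ⟨?_, ?_⟩)⟩
      · rw [← Fin.val_ne_iff]; simp only [ps]; omega
      · omega
      · simp only [ps]; omega
    · refine hsw _ _ h1.symm h2.symm ⟨ps_ne (by omega), Or.inr (Or.inl ?_)⟩
      simp only [ps]; omega
    · rw [← Fin.val_ne_iff]; simp only [ps]; omega
  · refine hsw _ _ ha h1.symm ⟨ha1, ?_⟩
    simp only [ps]; omega

lemma Cls.dep_one {m : ℕ} {F : Equiv.Perm (Fin (m + 5)) → Fin (m + 5) → ℚ} (hF : Cls m F)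
    (w w' : Equiv.Perm (Fin (m + 5))) (hw : w (ps m 1) = w' (ps m 1))
    (hw0 : w (ps m 0) = w' (ps m 0)) : F w (ps m 1) = F w' (ps m 1) := by
  refine hF.dep _ (ps m (m + 3)) (fun x => 2 ≤ x.val) ?_ w w' ?_
  · intro a ha ha1 w
    refine hF.A w _ _ ⟨ha1, ?_⟩ _ ?_ (ps_ne (by omega))
    · have := a.isLt
      simp only [ps]; omega
    · rw [← Fin.val_ne_iff]; simp only [ps]; omega
  · intro x hx
    by_cases h0 : x.val = 0
    · have : x = ps m 0 := Fin.ext h0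
      rw [this, hw0]
    · have : x = ps m 1 := Fin.ext (show x.val = 1 by omega)
      rw [this, hw]

lemma Cls.dep_pen {m : ℕ} {F : Equiv.Perm (Fin (m + 5)) → Fin (m + 5) → ℚ} (hF : Cls m F)
    (w w' : Equiv.Perm (Fin (m + 5))) (hw : w (ps m (m + 3)) = w' (ps m (m + 3)))
    (hw0 : w (ps m (m + 4)) = w' (ps m (m + 4))) : F w (ps m (m + 3)) = F w' (ps m (m + 3)) := by
  refine hF.dep _ (ps m 1) (fun x => x.val ≤ m + 2) ?_ w w' ?_
  · intro a ha ha1 w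
    refine hF.A w _ _ ⟨ha1, ?_⟩ _ ?_ (ps_ne (by omega))
    · have := a.isLt
      simp only [ps]; omega
    · rw [← Fin.val_ne_iff]; simp only [ps]; omega
  · intro x hx
    have := x.isLt
    by_cases h0 : x.val = m + 4
    · have : x = ps m (m + 4) := Fin.ext h0
      rw [this, hw0]
    · have : x = ps m (m + 3) := Fin.ext (show x.val = m + 3 by omega)
      rw [this, hw]

lemma Cls.normalize {m : ℕ} {F : Equiv.Perm (Fin (m + 5)) → Fin (m + 5) → ℚ} (hF : Cls m F) :
    ∃ l : Fin (m + 5) → ℚ, ∃ D, Cls m D ∧ (∀ w, D w (ps m 2) = 0) ∧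
      ∀ w k, F w k = l (w k) + D w k := by
  refine ⟨fun s => F (Equiv.swap (ps m 2) s) (ps m 2),
    fun w k => F w k - F (Equiv.swap (ps m 2) (w k)) (ps m 2), ⟨?_, ?_⟩, ?_, ?_⟩
  · intro w i j hij k hi hj
    simp only [Equiv.Perm.mul_apply, Equiv.swap_apply_of_ne_of_ne hi hj, hF.A w i j hij k hi hj]
  · intro w i j hij
    simp only [Equiv.Perm.mul_apply, Equiv.swap_apply_left, Equiv.swap_apply_right]
    linarith [hF.B w i j hij]
  · intro w
    rw [sub_eq_zero]
    apply hF.dep_gen _ (ps_ne (by omega)) (ps_ne (by omega))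
    rw [Equiv.swap_apply_left]
  · intro w k; ring

lemma Cls.indep {m : ℕ} {D : Equiv.Perm (Fin (m + 5)) → Fin (m + 5) → ℚ} (hD : Cls m D)
    (h0 : ∀ w, D w (ps m 2) = 0) (i : Fin (m + 5)) (P : Fin (m + 5) → Prop) (hi2 : i ≠ ps m 2)
    (hE : Edge (ps m 2) i) (hPi : ¬ P i) (hP2 : ¬ P (ps m 2))
    (hdep : ∀ w w' : Equiv.Perm (Fin (m + 5)), w i = w' i → (∀ p, P p → w p = w' p) → D w i = D w' i)
    (w w' : Equiv.Perm (Fin (m + 5))) (hw : ∀ p, P p → w p = w' p) : D w i = D w' i := by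
  by_cases hq : w i = w' i
  · exact hdep w w' hq hw
  obtain ⟨r, hr⟩ := w.surjective (w' i)
  have hri : r ≠ i := by rintro rfl; exact hq hr
  have hPr : ¬ P r := by
    intro h
    rw [hw r h] at hr
    exact hri (w'.injective hr)
  have hsP : ∀ p, P p → Equiv.swap (ps m 2) r p = p := fun p hp =>
    Equiv.swap_apply_of_ne_of_ne (by rintro rfl; exact hP2 hp) (by rintro rfl; exact hPr hp)
  have hsP' : ∀ p, P p → Equiv.swap (ps m 2) i p = p := fun p hp =>
    Equiv.swap_apply_of_ne_of_ne (by rintro rfl; exact hP2 hp) (by rintro rfl; exact hPi hp)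
  have e1 : D (w * Equiv.swap (ps m 2) r) i = D w i := by
    apply hdep
    · rw [Equiv.Perm.mul_apply, Equiv.swap_apply_of_ne_of_ne hi2 hri.symm]
    · intro p hp
      rw [Equiv.Perm.mul_apply, hsP p hp]
  have e2 := hD.B (w * Equiv.swap (ps m 2) r) _ _ hE
  rw [h0, h0, zero_add, zero_add, e1] at e2
  rw [← e2]
  apply hdep
  · rw [Equiv.Perm.mul_apply, Equiv.Perm.mul_apply, Equiv.swap_apply_right, Equiv.swap_apply_left, hr]
  · intro p hp
    rw [Equiv.Perm.mul_apply, Equiv.Perm.mul_apply, hsP' p hp, hsP p hp, hw p hp]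

lemma const_of {n : ℕ} (S : Equiv.Perm (Fin n) → ℚ) (a b : Fin n) (hab : a ≠ b)
    (h1 : ∀ w w' : Equiv.Perm (Fin n), w a = w' a → S w = S w')
    (h2 : ∀ w, S (w * Equiv.swap a b) = S w) (w w' : Equiv.Perm (Fin n)) : S w = S w' := by
  by_cases hq : w a = w' a
  · exact h1 _ _ hq
  obtain ⟨r, hr⟩ := w.surjective (w' a)
  have hra : r ≠ a := by rintro rfl; exact hq hr
  have e1 : S (w * Equiv.swap b r) = S w := by
    apply h1
    rw [Equiv.Perm.mul_apply, Equiv.swap_apply_of_ne_of_ne hab hra.symm]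
  rw [← e1, ← h2]
  apply h1
  rw [Equiv.Perm.mul_apply, Equiv.Perm.mul_apply, Equiv.swap_apply_left, Equiv.swap_apply_left, hr]

lemma deg_two_cls {m : ℕ} (g : Equiv.Perm (Fin (m + 5)) → MvPolynomial (Fin (m + 5)) ℚ)
    (hg : GK g) (c : Equiv.Perm (Fin (m + 5)) → Fin (m + 5) → ℚ)
    (hc : ∀ w, g w = ∑ s, C (c w s) * X s) : Cls m (fun w k => c w (w k)) := by
  have key : ∀ w i j, Edge i j → ∀ θ : Fin (m + 5) → ℚ, θ (w i) = θ (w j) →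
      ∑ s, c w s * θ s = ∑ s, c (w * Equiv.swap i j) s * θ s := by
    intro w i j hij θ hθ
    have h := hg w i j hij
    rw [hc, hc] at h
    have h2 := map_dvd (eval θ) h
    simp only [map_sub, eval_X, hθ, sub_self, zero_dvd_iff, map_sum, map_mul, eval_C] at h2
    linarith
  constructor
  · intro w i j hij k hi hj
    have h := key w i j hij (Pi.single (w k) 1) (by
      rw [Pi.single_eq_of_ne, Pi.single_eq_of_ne]
      · exact fun h => hj (w.injective h).symm
      · exact fun h => hi (w.injective h).symm)
    simp only [Pi.single_apply, mul_ite, mul_one, mul_zero, Finset.sum_ite_eq', Finset.mem_univ,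
      if_true] at h
    simp only [Equiv.Perm.mul_apply, Equiv.swap_apply_of_ne_of_ne hi hj]
    exact h.symm
  · intro w i j hij
    have hne : w i ≠ w j := fun h => hij.1 (w.injective h)
    have h := key w i j hij (Pi.single (w i) 1 + Pi.single (w j) 1) (by
      simp [Pi.single_apply, hne, hne.symm])
    simp only [Pi.add_apply, Pi.single_apply, mul_add, Finset.sum_add_distrib, mul_ite, mul_one,
      mul_zero, Finset.sum_ite_eq', Finset.mem_univ, if_true] at h
    simp only [Equiv.Perm.mul_apply, Equiv.swap_apply_left, Equiv.swap_apply_right]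
    linarith

lemma SS_first (m : ℕ) (β : Fin (m + 5) → ℚ) :
    (fun w : Equiv.Perm (Fin (m + 5)) => C (β (w (ps m 0))) * (X (w (ps m 0)) - X (w (ps m 1))))
      ∈ SS m := by
  have : (fun w : Equiv.Perm (Fin (m + 5)) =>
      C (β (w (ps m 0))) * (X (w (ps m 0)) - X (w (ps m 1)))) =
      ∑ a, tw (pp m (some a) none) (e1 m (some a) * e2 m none * C (β a)) := by
    funext w
    rw [Finset.sum_apply, Finset.sum_eq_single (w (ps m 0))]
    · rw [tw_pos _ (by simp [pp])]
      simp [e1, e2, mul_comm]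
    · intro a _ ha
      exact tw_neg _ (by simpa [pp] using ha.symm)
    · simp
  rw [this]
  exact Submodule.sum_mem _ fun a _ => SS_gen m (some a) none _ (fun _ => Iff.rfl) _ _ rfl

lemma SS_last (m : ℕ) (β : Fin (m + 5) → ℚ) :
    (fun w : Equiv.Perm (Fin (m + 5)) =>
      C (β (w (ps m (m + 4)))) * (X (w (ps m (m + 3))) - X (w (ps m (m + 4))))) ∈ SS m := by
  have : (fun w : Equiv.Perm (Fin (m + 5)) =>
      C (β (w (ps m (m + 4)))) * (X (w (ps m (m + 3))) - X (w (ps m (m + 4))))) =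
      ∑ a, tw (pp m none (some a)) (e1 m none * e2 m (some a) * C (β a)) := by
    funext w
    rw [Finset.sum_apply, Finset.sum_eq_single (w (ps m (m + 4)))]
    · rw [tw_pos _ (by simp [pp])]
      simp [e1, e2, mul_comm]
    · intro a _ ha
      exact tw_neg _ (by simpa [pp] using ha.symm)
    · simp
  rw [this]
  exact Submodule.sum_mem _ fun a _ => SS_gen m none (some a) _ (fun _ => Iff.rfl) _ _ rfl

lemma SS_mid (m : ℕ) (M : Fin (m + 5) → ℚ) :
    (fun w : Equiv.Perm (Fin (m + 5)) => ∑ k, C (M k) * X (w k)) ∈ SS m := by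
  have : (fun w : Equiv.Perm (Fin (m + 5)) => ∑ k, C (M k) * X (w k)) =
      tw (pp m none none) (∑ k, C (M k) * X k) := by
    funext w
    rw [tw_pos _ (by simp [pp])]
    simp
  rw [this]
  exact SS_gen m none none _ (fun _ => Iff.rfl) _ (∑ k, C (M k) * X k) (by simp only [e1, e2, one_mul])

lemma deg_two_mem (m : ℕ) (g : Equiv.Perm (Fin (m + 5)) → MvPolynomial (Fin (m + 5)) ℚ)
    (hg : GK g) (hdeg : ∀ w, (g w).IsHomogeneous 1) : g ∈ SS m := by
  choose c hc using fun w => lin_form (g w) (hdeg w)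
  obtain ⟨l, D, hD, hD2, hF⟩ := (deg_two_cls g hg c hc).normalize
  have mE : ∀ i : Fin (m + 5), 1 ≤ i.val → i.val ≤ m + 3 → i.val ≠ 2 → Edge (ps m 2) i := by
    intro i h1 h2 h3
    refine ⟨?_, ?_⟩
    · rw [← Fin.val_ne_iff]; simp only [ps]; omega
    · simp only [ps]; omega
  -- position one
  have hone : ∀ w w' : Equiv.Perm (Fin (m + 5)), w (ps m 0) = w' (ps m 0) →
      D w (ps m 1) = D w' (ps m 1) := by
    intro w w' h
    refine hD.indep hD2 (ps m 1) (fun p => p = ps m 0) (ps_ne (by omega)) (mE _ ?_ ?_ ?_)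
      (ps_ne (by omega)) (ps_ne (by omega)) ?_ w w' (by rintro p rfl; exact h)
    · simp [ps]
    · simp [ps]
    · simp [ps]
    · intro w w' h1 h2
      exact hD.dep_one w w' h1 (h2 _ rfl)
  have hpen : ∀ w w' : Equiv.Perm (Fin (m + 5)), w (ps m (m + 4)) = w' (ps m (m + 4)) →
      D w (ps m (m + 3)) = D w' (ps m (m + 3)) := by
    intro w w' h
    refine hD.indep hD2 (ps m (m + 3)) (fun p => p = ps m (m + 4)) (ps_ne (by omega)) (mE _ ?_ ?_ ?_)
      (ps_ne (by omega)) (ps_ne (by omega)) ?_ w w' (by rintro p rfl; exact h)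
    · simp [ps]
    · simp [ps]
    · simp [ps]
    · intro w w' h1 h2
      exact hD.dep_pen w w' h1 (h2 _ rfl)
  have hmid : ∀ i : Fin (m + 5), 2 ≤ i.val → i.val ≤ m + 2 → ∀ w w', D w i = D w' i := by
    intro i h1 h2 w w'
    by_cases h3 : i.val = 2
    · have : i = ps m 2 := Fin.ext h3
      rw [this, hD2, hD2]
    · refine hD.indep hD2 i (fun _ => False) (fun h => h3 (congrArg Fin.val h))
        (mE i (by omega) (by omega) h3) not_false not_false ?_ w w' (by simp)
      intro w w' h _
      refine hD.dep_gen i ?_ ?_ w w' h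
      · rw [← Fin.val_ne_iff]; simp only [ps]; omega
      · rw [← Fin.val_ne_iff]; simp only [ps]; omega
  have hk1 : ∀ w w', D w (ps m 0) + D w (ps m 1) = D w' (ps m 0) + D w' (ps m 1) := by
    refine const_of (fun w => D w (ps m 0) + D w (ps m 1)) (ps m 0) (ps m 1) (ps_ne (by omega)) ?_ ?_
    · intro w w' h
      simp only [hone w w' h, hD.dep_gen (ps m 0) (ps_ne (by omega)) (ps_ne (by omega)) w w' h]
    · intro w
      exact hD.B w _ _ ⟨ps_ne (by omega), by simp [ps]⟩
  have hk2 : ∀ w w', D w (ps m (m + 4)) + D w (ps m (m + 3)) =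
      D w' (ps m (m + 4)) + D w' (ps m (m + 3)) := by
    refine const_of (fun w => D w (ps m (m + 4)) + D w (ps m (m + 3))) (ps m (m + 4)) (ps m (m + 3))
      (ps_ne (by omega)) ?_ ?_
    · intro w w' h
      simp only [hpen w w' h, hD.dep_gen (ps m (m + 4)) (ps_ne (by omega)) (ps_ne (by omega)) w w' h]
    · intro w
      exact hD.B w _ _ ⟨ps_ne (by omega), by simp [ps]⟩
  -- assemble
  set β : Fin (m + 5) → ℚ := fun q => D (Equiv.swap (ps m 0) q) (ps m 1) with hβ
  set β' : Fin (m + 5) → ℚ := fun q => D (Equiv.swap (ps m (m + 4)) q) (ps m (m + 3)) with hβ'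
  have hDβ : ∀ w : Equiv.Perm (Fin (m + 5)), D w (ps m 1) = β (w (ps m 0)) := by
    intro w; apply hone; rw [Equiv.swap_apply_left]
  have hDβ' : ∀ w : Equiv.Perm (Fin (m + 5)), D w (ps m (m + 3)) = β' (w (ps m (m + 4))) := by
    intro w; apply hpen; rw [Equiv.swap_apply_left]
  set M : Fin (m + 5) → ℚ := fun k =>
    if k = ps m 0 then D 1 (ps m 0) + D 1 (ps m 1) else
    if k = ps m 1 then 0 else if k = ps m (m + 3) then 0 else
    if k = ps m (m + 4) then D 1 (ps m (m + 4)) + D 1 (ps m (m + 3)) else D 1 k with hM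
  have hDM : ∀ w k, D w k = M k - (if k = ps m 0 then β (w (ps m 0)) else 0)
      + (if k = ps m 1 then β (w (ps m 0)) else 0)
      + (if k = ps m (m + 3) then β' (w (ps m (m + 4))) else 0)
      - (if k = ps m (m + 4) then β' (w (ps m (m + 4))) else 0) := by
    intro w k
    have n01 : ps m 0 ≠ ps m 1 := ps_ne (by omega)
    have n03 : ps m 0 ≠ ps m (m + 3) := ps_ne (by omega)
    have n04 : ps m 0 ≠ ps m (m + 4) := ps_ne (by omega)
    have n13 : ps m 1 ≠ ps m (m + 3) := ps_ne (by omega)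
    have n14 : ps m 1 ≠ ps m (m + 4) := ps_ne (by omega)
    have n34 : ps m (m + 3) ≠ ps m (m + 4) := ps_ne (by omega)
    rw [hM]
    dsimp only
    rw [← hDβ, ← hDβ']
    by_cases h0 : k = ps m 0
    · rw [h0, if_pos rfl, if_pos rfl, if_neg n01, if_neg n03, if_neg n04]
      linarith [hk1 w 1]
    by_cases h1 : k = ps m 1
    · rw [h1, if_neg n01.symm, if_pos rfl, if_neg n01.symm, if_pos rfl, if_neg n13, if_neg n14]
      ring
    by_cases h3 : k = ps m (m + 3)
    · rw [h3, if_neg n03.symm, if_neg n13.symm, if_pos rfl, if_neg n03.symm, if_neg n13.symm,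
        if_pos rfl, if_neg n34]
      ring
    by_cases h4 : k = ps m (m + 4)
    · rw [h4, if_neg n04.symm, if_neg n14.symm, if_neg n34.symm, if_pos rfl, if_neg n04.symm,
        if_neg n14.symm, if_neg n34.symm, if_pos rfl]
      linarith [hk2 w 1]
    · rw [if_neg h0, if_neg h1, if_neg h3, if_neg h4, if_neg h0, if_neg h1, if_neg h3, if_neg h4]
      have h0' : k.val ≠ 0 := fun h => h0 (Fin.ext h)
      have h1' : k.val ≠ 1 := fun h => h1 (Fin.ext h)
      have h3' : k.val ≠ m + 3 := fun h => h3 (Fin.ext h)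
      have h4' : k.val ≠ m + 4 := fun h => h4 (Fin.ext h)
      have := k.isLt
      rw [hmid k (by omega) (by omega) w 1]
      ring
  have hgw : g = (fun _ => ∑ s, C (l s) * X s) + (fun w => ∑ k, C (M k) * X (w k))
      - (fun w => C (β (w (ps m 0))) * (X (w (ps m 0)) - X (w (ps m 1))))
      + (fun w => C (β' (w (ps m (m + 4)))) * (X (w (ps m (m + 3))) - X (w (ps m (m + 4))))) := by
    funext w
    simp only [Pi.add_apply, Pi.sub_apply]
    rw [hc, ← Equiv.sum_comp w (fun s => C (c w s) * X s), ← Equiv.sum_comp w (fun s => C (l s) * X s)]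
    have : ∀ k, C (c w (w k)) * X (w k) = C (l (w k)) * X (w k) + C (M k) * X (w k)
        - (if k = ps m 0 then C (β (w (ps m 0))) * X (w k) else 0)
        + (if k = ps m 1 then C (β (w (ps m 0))) * X (w k) else 0)
        + (if k = ps m (m + 3) then C (β' (w (ps m (m + 4)))) * X (w k) else 0)
        - (if k = ps m (m + 4) then C (β' (w (ps m (m + 4)))) * X (w k) else 0) := by
      intro k
      rw [hF w k, hDM w k]
      simp only [map_add, map_sub, apply_ite C, map_zero]
      split_ifs <;> ring
    rw [Finset.sum_congr rfl fun k _ => this k]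
    simp only [Finset.sum_add_distrib, Finset.sum_sub_distrib, Finset.sum_ite_eq', Finset.mem_univ,
      if_true]
    ring
  rw [hgw]
  exact Submodule.add_mem _ (Submodule.sub_mem _ (Submodule.add_mem _ (SS_scalar m _) (SS_mid m M))
    (SS_first m β)) (SS_last m β')


end HessNG

/-- let `n ≥ 5` and `h = h_n = (2, n−1, …, n−1, n, n)` (in 0-based form:
`h(0) = 1`, `h(j) = n-2` for `1 ≤ j ≤ n-3`, and `h(n-2) = h(n-1) = n-1`).  Then the
`ℚ`-algebra `R(h)` is NOT generated by the images of the degree-2 elements of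
`H(h) ⊗ ℚ`. -/
theorem not_generated_in_degree_two (n : ℕ) (hn : 5 ≤ n) (h : Fin n → Fin n)
    (hval : ∀ j : Fin n, (h j : ℕ) =
      if (j : ℕ) = 0 then 1 else if (j : ℕ) + 2 < n then n - 2 else n - 1) :
    ¬ GenInDegTwoQ h := by
  obtain ⟨m, rfl⟩ : ∃ m, n = m + 5 := ⟨n - 5, by omega⟩
  intro H
  obtain ⟨g, hg, a, ha, hfa⟩ := H _ ((HessNG.gk_iff hn h hval _).2 (HessNG.gk_fA m))
  apply HessNG.not_van m
  rw [hfa]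
  refine HessNG.Van.add (HessNG.Van.of_SS (HessNG.adjoin_SS _ ?_ hg))
    (HessNG.Van.sum _ _ fun i _ => HessNG.Van.mul_X ((HessNG.gk_iff hn h hval _).1 (ha i)) i)
  rintro f ⟨hf1, hf2⟩
  exact HessNG.deg_two_mem m f ((HessNG.gk_iff hn h hval _).1 hf1) hf2
end

section
/- Let h be a Hessenberg function on [n] of lollipop form, let r ∈ [n], and let S_n^r = {w ∈ S_n : w(r) = n}. Let C be a connected component of the induced labeled subgraph Γ(S_n^r, h), and let H(C) denote its graph cohomology. Then the restriction map is surjective in degree 2: every element of H(C) all of whose values are homogeneous polynomials of degree 1 or zero is the restriction to the vertices of C of an element of H(h) all of whose values are homogeneous polynomials of degree 1 or zero. -/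
open MvPolynomial

/-- The GKM condition: `f` belongs to the GKM ring `H(h)` of the Hessenberg function `h`
(0-based indexing: position `j : Fin n` corresponds to `j+1 ∈ [n]`). -/
def InGKM {n : ℕ} (h : Fin n → Fin n)
    (f : Equiv.Perm (Fin n) → MvPolynomial (Fin n) ℤ) : Prop :=
  ∀ (w : Equiv.Perm (Fin n)) (i j : Fin n), j < i → i ≤ h j →
    f w - f (w * Equiv.swap i j) ∈ Ideal.span {X (w i) - X (w j)}

/-- `h` is of lollipop form: there are `1 ≤ a < b ≤ n` (1-based) with `h(j) = a+1` for
`1 ≤ j ≤ a`, `h(j) = j+1` for `a < j < b`, and `h(j) = n` for `b ≤ j ≤ n`.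
Below `a b : ℕ` are the 0-based versions (`a = a₁ - 1`, `b = b₁ - 1`). -/
def Lollipop {n : ℕ} (h : Fin n → Fin n) : Prop :=
  ∃ a b : ℕ, a < b ∧ b ≤ n - 1 ∧
    (∀ j : Fin n, (j : ℕ) ≤ a → (h j : ℕ) = a + 1) ∧
    (∀ j : Fin n, a < (j : ℕ) → (j : ℕ) < b → (h j : ℕ) = (j : ℕ) + 1) ∧
    (∀ j : Fin n, b ≤ (j : ℕ) → (h j : ℕ) = n - 1)

/-- The vertex set of the connected component containing `σ` of the labeled subgraph
`Γ(S_n^r, h)` of the GKM graph of `h` induced on `S_n^r = {w : w(r) = n}`: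
two vertices of `S_n^r` are adjacent when they differ by a transposition `(i,j)` with
`j < i ≤ h(j)`. -/
def component {n : ℕ} (h : Fin n → Fin n) (r : Fin n) (σ : Equiv.Perm (Fin n)) :
    Set (Equiv.Perm (Fin n)) :=
  {w | Relation.ReflTransGen
    (fun u v => ((u r : ℕ) = n - 1) ∧ ((v r : ℕ) = n - 1) ∧
      ∃ i j : Fin n, j < i ∧ i ≤ h j ∧ v = u * Equiv.swap i j) σ w}


namespace LolProof

open Relation Equiv

/-- Adjacency of positions, avoiding the position `r`. -/
def E {n : ℕ} (h : Fin n → Fin n) (r i j : Fin n) : Prop :=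
  i ≠ r ∧ j ≠ r ∧ ((j < i ∧ i ≤ h j) ∨ (i < j ∧ j ≤ h i))

lemma E.symm {n : ℕ} {h : Fin n → Fin n} {r i j : Fin n} (H : E h r i j) : E h r j i :=
  ⟨H.2.1, H.1, H.2.2.symm⟩

lemma E.ne {n : ℕ} {h : Fin n → Fin n} {r i j : Fin n} (H : E h r i j) : i ≠ j := by
  rcases H.2.2 with H | H
  · exact H.1.ne'
  · exact H.1.ne

/-- Reachability of permutations by swaps of `A`-related positions. -/
def Reach {n : ℕ} (A : Fin n → Fin n → Prop) : Perm (Fin n) → Perm (Fin n) → Prop :=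
  ReflTransGen (fun u v => ∃ i j, A i j ∧ v = u * swap i j)

lemma rtg_symm {α : Type*} {A : α → α → Prop} (hA : ∀ i j, A i j → A j i) {x y : α}
    (H : ReflTransGen A x y) : ReflTransGen A y x := by
  induction H with
  | refl => exact .refl
  | tail _ h2 ih => exact ReflTransGen.head (hA _ _ h2) ih

lemma rtg_mono {α : Type*} {A B : α → α → Prop} (hA : ∀ i j, A i j → B i j) {x y : α}
    (H : ReflTransGen A x y) : ReflTransGen B x y := by
  induction H with
  | refl => exact .refl
  | tail _ h2 ih => exact ih.tail (hA _ _ h2)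

lemma reach_symm {n : ℕ} {A : Fin n → Fin n → Prop} {u v : Perm (Fin n)}
    (H : Reach A u v) : Reach A v u := by
  refine rtg_symm ?_ H
  rintro u v ⟨i, j, hij, rfl⟩
  exact ⟨i, j, hij, by simp [mul_assoc]⟩

lemma reach_mono {n : ℕ} {A B : Fin n → Fin n → Prop} (hAB : ∀ i j, A i j → B i j)
    {u v : Perm (Fin n)} (H : Reach A u v) : Reach B u v := by
  refine rtg_mono ?_ H
  rintro u v ⟨i, j, hij, rfl⟩
  exact ⟨i, j, hAB _ _ hij, rfl⟩

lemma reach_of_conn {n : ℕ} {A : Fin n → Fin n → Prop}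
    (hne : ∀ i j, A i j → i ≠ j) (w π : Perm (Fin n))
    (hπ : ∀ x, ReflTransGen A x (π x)) : Reach A w (w * π) := by
  set S : Set (Perm (Fin n)) := {s | ∃ i j, A i j ∧ s = swap i j} with hS
  have hsw : ∀ f ∈ S, f.IsSwap := by
    rintro f ⟨i, j, hij, rfl⟩
    exact ⟨i, j, hne _ _ hij, rfl⟩
  have horb : ∀ x y, ReflTransGen A x y → y ∈ MulAction.orbit (Subgroup.closure S) x := by
    intro x y H
    induction H with
    | refl => exact MulAction.mem_orbit_self _
    | @tail b c _ h2 ih =>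
      rw [← MulAction.orbit_eq_iff.mpr ih]
      exact ⟨⟨swap b c, Subgroup.subset_closure ⟨b, c, h2, rfl⟩⟩, swap_apply_left b c⟩
  have hmem : π ∈ Subgroup.closure S :=
    (_root_.mem_closure_isSwap hsw).2 ⟨Set.toFinite _, fun x => horb _ _ (hπ x)⟩
  refine Subgroup.closure_induction_right (p := fun x _ => Reach A w (w * x)) ?_ ?_ ?_ hmem
  · rw [mul_one]; exact .refl
  · rintro x _ y ⟨i, j, hij, rfl⟩ ih
    exact ReflTransGen.tail ih ⟨i, j, hij, by rw [mul_assoc]⟩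
  · rintro x _ y ⟨i, j, hij, rfl⟩ ih
    exact ReflTransGen.tail ih ⟨i, j, hij, by rw [mul_assoc, swap_inv]⟩

lemma conn_of_reach {n : ℕ} {A : Fin n → Fin n → Prop} (hA : ∀ i j, A i j → A j i)
    {u v : Perm (Fin n)} (H : Reach A u v) : ∀ x y, u x = v y → ReflTransGen A x y := by
  induction H with
  | refl => intro x y hxy; rw [u.injective hxy]
  | @tail b c _ h2 ih =>
    obtain ⟨i, j, hij, rfl⟩ := h2
    intro x y hxy
    have h3 := ih x (swap i j y) hxy
    by_cases hyi : y = i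
    · subst hyi
      rw [swap_apply_left] at h3
      exact h3.tail (hA _ _ hij)
    · by_cases hyj : y = j
      · subst hyj
        rw [swap_apply_right] at h3
        exact h3.tail hij
      · rwa [swap_apply_of_ne_of_ne hyi hyj] at h3

lemma inv_of_reach {n : ℕ} {A B : Fin n → Fin n → Prop} {σ : Perm (Fin n)}
    (hAB : ∀ i j, A i j → B i j) {α : Type*} (Φ : Perm (Fin n) → α)
    (hΦ : ∀ w, Reach B σ w → ∀ i j, A i j → Φ (w * swap i j) = Φ w)
    {w w' : Perm (Fin n)} (hw : Reach B σ w) (H : Reach A w w') : Φ w' = Φ w := by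
  induction H with
  | refl => rfl
  | @tail b c h1 h2 ih =>
    obtain ⟨i, j, hij, rfl⟩ := h2
    rw [hΦ b (ReflTransGen.trans hw (reach_mono hAB h1)) i j hij, ih]

section conv
variable {n : ℕ} {h : Fin n → Fin n} {r : Fin n}

lemma crossing {x y : Fin n} (H : ReflTransGen (E h r) x y) (hx : x < r) :
    y < r ∨ ∃ i j, i < r ∧ r < j ∧ j ≤ h i := by
  induction H with
  | refl => exact Or.inl hx
  | @tail b c _ h2 ih =>
    rcases ih with ih | ih
    · rcases lt_or_gt_of_ne h2.2.1 with h3 | h3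
      · exact Or.inl h3
      · right
        refine ⟨b, c, ih, h3, ?_⟩
        rcases h2.2.2 with h4 | h4
        · exact absurd (h4.1.trans ih) (not_lt.2 h3.le)
        · exact h4.2
    · exact Or.inr ih

lemma chain (hmono : Monotone h) (hstep : ∀ i j : Fin n, (j : ℕ) = i + 1 → j ≤ h i) :
    ∀ (d : ℕ) (x y : Fin n), (y : ℕ) ≤ x + d → x < y → x ≠ r → y ≠ r →
      (x < r → r < y → ∃ i j, i < r ∧ r < j ∧ j ≤ h i) →
      ReflTransGen (fun i j => E h r i j ∧ (x ≤ i ∧ i ≤ y) ∧ (x ≤ j ∧ j ≤ y)) x y := by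
  intro d
  induction d with
  | zero => intro x y h1 h2; exfalso; rw [Fin.lt_def] at h2; omega
  | succ d ih =>
    intro x y hd hxy hx hy hc
    -- the next position
    have key : ∃ z : Fin n, x < z ∧ z ≤ y ∧ z ≠ r ∧ z ≤ h x ∧ (r < z ∨ z < r) ∧
        (x < r → r < z → True) := by
      by_cases h1 : (x : ℕ) + 1 = r
      · have hxr : x < r := by rw [Fin.lt_def]; omega
        have hry : r < y := by
          rw [Fin.lt_def] at hxy ⊢
          have : (y : ℕ) ≠ r := fun e => hy (Fin.ext e)
          omega
        obtain ⟨i, j, hi, hj, hij⟩ := hc hxr hry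
        have hlt : (r : ℕ) + 1 < n := by rw [Fin.lt_def] at hry; omega
        refine ⟨⟨r + 1, hlt⟩, ?_, ?_, ?_, ?_, ?_, fun _ _ => trivial⟩
        · rw [Fin.lt_def]; simp; omega
        · rw [Fin.le_def]; simp; rw [Fin.lt_def] at hry; omega
        · intro e; have := congrArg Fin.val e; simp at this
        · have hix : i ≤ x := by rw [Fin.le_def]; rw [Fin.lt_def] at hi; omega
          refine le_trans ?_ (hij.trans (hmono hix))
          rw [Fin.le_def]; simp; rw [Fin.lt_def] at hj; omega
        · left; rw [Fin.lt_def]; simp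
      · have hlt : (x : ℕ) + 1 < n := by rw [Fin.lt_def] at hxy; omega
        have hzr : (⟨x + 1, hlt⟩ : Fin n) ≠ r := by
          intro e; exact h1 (congrArg Fin.val e)
        refine ⟨⟨x + 1, hlt⟩, ?_, ?_, hzr, hstep _ _ rfl, (lt_or_gt_of_ne hzr).symm,
          fun _ _ => trivial⟩
        · rw [Fin.lt_def]; simp
        · rw [Fin.le_def]; simp; rw [Fin.lt_def] at hxy; omega
    obtain ⟨z, hxz, hzy, hzr, hzh, -, -⟩ := key
    refine ReflTransGen.head (b := z) ⟨⟨hx, hzr, Or.inr ⟨hxz, hzh⟩⟩, ⟨le_rfl, hxy.le⟩, hxz.le, hzy⟩ ?_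
    rcases hzy.eq_or_lt with e | hlt
    · rw [e]
    · refine rtg_mono ?_ (ih z y ?_ hlt hzr hy fun h1 h2 => hc (hxz.trans h1) h2)
      · rintro i j ⟨h1, h2, h3⟩
        exact ⟨h1, ⟨hxz.le.trans h2.1, h2.2⟩, hxz.le.trans h3.1, h3.2⟩
      · rw [Fin.lt_def] at hxz; omega

lemma rtg_ne_r {x y : Fin n} (H : ReflTransGen (E h r) x y) : x = y ∨ (x ≠ r ∧ y ≠ r) := by
  induction H with
  | refl => exact Or.inl rfl
  | @tail b c _ h2 ih =>
    right
    rcases ih with rfl | ih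
    · exact ⟨h2.1, h2.2.1⟩
    · exact ⟨ih.1, h2.2.1⟩

lemma conv (hmono : Monotone h) (hstep : ∀ i j : Fin n, (j : ℕ) = i + 1 → j ≤ h i)
    {P : Fin n → Prop} (hP : ∀ x y z, P x → P y → x ≤ z → z ≤ y → P z)
    {x y : Fin n} (H : ReflTransGen (E h r) x y) (hx : P x) (hy : P y) :
    ReflTransGen (fun i j => E h r i j ∧ P i ∧ P j) x y := by
  have main : ∀ x y : Fin n, ReflTransGen (E h r) x y → P x → P y → x < y →
      ReflTransGen (fun i j => E h r i j ∧ P i ∧ P j) x y := by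
    intro x y H hx hy hxy
    rcases rtg_ne_r H with e | ⟨h1, h2⟩
    · exact absurd e hxy.ne
    refine rtg_mono ?_ (chain hmono hstep (y : ℕ) x y (by omega) hxy h1 h2 ?_)
    · rintro i j ⟨h1, h2, h3⟩
      exact ⟨h1, hP _ _ _ hx hy h2.1 h2.2, hP _ _ _ hx hy h3.1 h3.2⟩
    · intro h3 h4
      rcases crossing H h3 with h5 | h5
      · exact absurd (h5.trans h4) (lt_irrefl _)
      · exact h5
  rcases lt_trichotomy x y with hlt | rfl | hlt
  · exact main x y H hx hy hlt
  · exact .refl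
  · refine rtg_symm ?_ (main y x (rtg_symm (fun _ _ => E.symm) H) hy hx hlt)
    rintro i j ⟨h1, h2, h3⟩
    exact ⟨h1.symm, h3, h2⟩

/-- Paths avoiding an extreme point of a component. -/
lemma avoid (hmono : Monotone h) (hstep : ∀ i j : Fin n, (j : ℕ) = i + 1 → j ≤ h i)
    {Q : Fin n → Prop} (hQ : ∀ x y z, Q x → Q y → x ≤ z → z ≤ y → Q z) {x1 : Fin n}
    (hQ1 : ¬ Q x1) (hQ2 : ∀ y, ReflTransGen (E h r) x1 y → y ≠ x1 → Q y)
    {y z : Fin n} (H : ReflTransGen (E h r) y z) (hy : y ≠ x1) (hz : z ≠ x1) :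
    ReflTransGen (fun i j => E h r i j ∧ i ≠ x1 ∧ j ≠ x1) y z := by
  by_cases h1 : ReflTransGen (E h r) x1 y
  · refine rtg_mono ?_ (conv hmono hstep hQ H (hQ2 _ h1 hy) (hQ2 _ (h1.trans H) hz))
    rintro i j ⟨h1, h2, h3⟩
    exact ⟨h1, fun e => hQ1 (e ▸ h2), fun e => hQ1 (e ▸ h3)⟩
  · have gen : ∀ z, ReflTransGen (E h r) y z →
        ReflTransGen (fun i j => E h r i j ∧ i ≠ x1 ∧ j ≠ x1) y z := by
      intro z H
      induction H with
      | refl => exact .refl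
      | @tail b c h3 h4 ih =>
        refine ih.tail ⟨h4, ?_, ?_⟩
        · rintro rfl; exact h1 (rtg_symm (fun _ _ => E.symm) h3)
        · rintro rfl; exact h1 (rtg_symm (fun _ _ => E.symm) (h3.tail h4))
    exact gen z H

end conv

section vec
variable {n : ℕ}

/-- The GKM edge condition for vector-valued functions. -/
def EC (g : Perm (Fin n) → Fin n → ℤ) (w : Perm (Fin n)) (i j : Fin n) : Prop :=
  (∀ x, x ≠ w i → x ≠ w j → g (w * swap i j) x = g w x) ∧
    g (w * swap i j) (w i) + g (w * swap i j) (w j) = g w (w i) + g w (w j)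

lemma EC.symm {g : Perm (Fin n) → Fin n → ℤ} {w : Perm (Fin n)} {i j : Fin n}
    (H : EC g w i j) : EC g w j i := by
  refine ⟨fun x h1 h2 => ?_, ?_⟩
  · rw [swap_comm]; exact H.1 x h2 h1
  · rw [swap_comm]; have := H.2; omega

lemma EC.add {g g' : Perm (Fin n) → Fin n → ℤ} {w : Perm (Fin n)} {i j : Fin n}
    (H : EC g w i j) (H' : EC g' w i j) : EC (g + g') w i j := by
  refine ⟨fun x h1 h2 => ?_, ?_⟩
  · simp only [Pi.add_apply]; rw [H.1 x h1 h2, H'.1 x h1 h2]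
  · simp only [Pi.add_apply]; have := H.2; have := H'.2; omega

lemma EC.neg {g : Perm (Fin n) → Fin n → ℤ} {w : Perm (Fin n)} {i j : Fin n}
    (H : EC g w i j) : EC (-g) w i j := by
  refine ⟨fun x h1 h2 => ?_, ?_⟩
  · simp only [Pi.neg_apply]; rw [H.1 x h1 h2]
  · simp only [Pi.neg_apply]; have := H.2; omega

lemma total_of_pair {u v : Fin n → ℤ} {p q : Fin n} (hpq : p ≠ q)
    (hoff : ∀ x, x ≠ p → x ≠ q → u x = v x) :
    ∑ x, u x - ∑ x, v x = (u p + u q) - (v p + v q) := by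
  rw [← Finset.sum_sub_distrib, Finset.sum_eq_add p q hpq]
  · ring
  · rintro c - ⟨h1, h2⟩; rw [hoff c h1 h2, sub_self]
  · intro h; exact absurd (Finset.mem_univ _) h
  · intro h; exact absurd (Finset.mem_univ _) h

/-- Edge coefficient. -/
def cf (g : Perm (Fin n) → Fin n → ℤ) (w : Perm (Fin n)) (i j : Fin n) : ℤ :=
  g w (w i) - g (w * swap i j) (w i)

lemma cf_symm {g : Perm (Fin n) → Fin n → ℤ} {w : Perm (Fin n)} {i j : Fin n}
    (H : EC g w i j) : cf g w j i = - cf g w i j := by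
  unfold cf
  rw [swap_comm j i]
  have := H.2
  omega

lemma cf_self {g : Perm (Fin n) → Fin n → ℤ} {w : Perm (Fin n)} {i j : Fin n}
    (H : EC g w i j) : cf g (w * swap i j) i j = cf g w i j := by
  unfold cf
  have := H.2
  simp [mul_assoc]
  omega

lemma cf_comm {g : Perm (Fin n) → Fin n → ℤ} {w : Perm (Fin n)} {i j k l : Fin n}
    (hik : i ≠ k) (hil : i ≠ l) (hjk : j ≠ k) (hjl : j ≠ l)
    (H1 : EC g w k l) (H2 : EC g (w * swap i j) k l) :
    cf g (w * swap k l) i j = cf g w i j := by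
  unfold cf
  have e : w * swap k l * swap i j = w * swap i j * swap k l := by
    rw [mul_assoc, mul_assoc]
    congr 1
    ext x
    simp only [Perm.mul_apply, swap_apply_def]
    split_ifs <;> simp_all
  rw [e]
  have a1 : (w * swap k l) i = w i := by
    simp [swap_apply_of_ne_of_ne hik hil]
  rw [a1, H1.1 (w i) (by simpa using hik) (by simpa using hil), H2.1 (w i)]
  · simp [swap_apply_of_ne_of_ne hik.symm hjk.symm, hik]
  · simp [swap_apply_of_ne_of_ne hil.symm hjl.symm, hil]

lemma swap_id1 {i j k : Fin n} (hij : i ≠ j) (hik : i ≠ k) (hjk : j ≠ k) :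
    swap i j * swap j k * swap i k = swap j k := by
  ext x
  simp only [Perm.mul_apply, swap_apply_def]
  split_ifs <;> simp_all

lemma cf_tri {g : Perm (Fin n) → Fin n → ℤ} {w : Perm (Fin n)} {i j k : Fin n}
    (hij : i ≠ j) (hik : i ≠ k) (hjk : j ≠ k)
    (H1 : EC g w i j) (H2 : EC g (w * swap i j) j k) (H3 : EC g (w * swap i j * swap j k) i k)
    (H4 : EC g w j k) :
    cf g (w * swap i j) j k = cf g w j k := by
  have e : w * swap i j * swap j k * swap i k = w * swap j k := by
    rw [mul_assoc, mul_assoc, ← mul_assoc (swap i j), swap_id1 hij hik hjk]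
  have a1 := H1.1 (w k) (by simpa using hik.symm) (by simpa using hjk.symm)
  have a3 := H3.1 (w k) (by simp [swap_apply_of_ne_of_ne hij hik, hjk.symm])
    (by simp [hik.symm])
  rw [e] at a3
  have b2 := H2.2
  have b4 := H4.2
  simp [swap_apply_of_ne_of_ne hik.symm hjk.symm] at b2
  unfold cf
  simp
  omega

lemma cf_hex {g : Perm (Fin n) → Fin n → ℤ} {w : Perm (Fin n)} {u i j : Fin n}
    (hui : u ≠ i) (huj : u ≠ j) (hij : i ≠ j)
    (hinv1 : g (w * swap u i) = g w)
    (hinv2 : g (w * swap i j * swap u i) = g (w * swap i j))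
    (hinv3 : g (w * swap u i * swap i j * swap u i) = g (w * swap u i * swap i j))
    (H1 : EC g w i j) (H2 : EC g (w * swap u i) i j)
    (H3 : EC g (w * swap i j * swap u i) i j) :
    cf g (w * swap u i) i j = cf g w i j := by
  have e : w * swap i j * swap u i * swap i j = w * swap u i * swap i j * swap u i := by
    simp only [mul_assoc]
    congr 1
    ext x
    simp only [Perm.mul_apply, swap_apply_def]
    split_ifs <;> simp_all
  -- coordinates: `w = (a,b,c)` at positions `(u,i,j)`
  have a1 := H1.1 (w u) (by simpa using hui) (by simpa using huj)
  have a2 := H2.1 (w i) (by simp [hui.symm])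
    (by simp [swap_apply_of_ne_of_ne huj.symm hij.symm, hij])
  have a3 := H3.1 (w j) (by simp [swap_apply_of_ne_of_ne hui huj, huj.symm])
    (by simp [swap_apply_of_ne_of_ne huj.symm hij.symm, hij.symm])
  have b1 := H1.2
  have b2 := H2.2
  have b3 := H3.2
  rw [e, hinv2, hinv3] at a3 b3
  simp [swap_apply_of_ne_of_ne hui huj, swap_apply_of_ne_of_ne huj.symm hij.symm] at b2 b3
  rw [hinv1] at a2 b2
  unfold cf
  rw [hinv1]
  simp
  omega

variable {h : Fin n → Fin n} {r : Fin n} {σ : Perm (Fin n)}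

/-- The GKM condition on the component of `σ`. -/
def GK (h : Fin n → Fin n) (r : Fin n) (σ : Perm (Fin n))
    (g : Perm (Fin n) → Fin n → ℤ) : Prop :=
  ∀ w, Reach (E h r) σ w → ∀ i j, E h r i j → EC g w i j

/-- The GKM condition everywhere. -/
def GA (h : Fin n → Fin n) (g : Perm (Fin n) → Fin n → ℤ) : Prop :=
  ∀ w i j, j < i → i ≤ h j → EC g w i j

lemma GA.gk {g : Perm (Fin n) → Fin n → ℤ} (H : GA h g) : GK h r σ g := by
  intro w _ i j hij
  rcases hij.2.2 with h1 | h1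
  · exact H w i j h1.1 h1.2
  · exact (H w j i h1.1 h1.2).symm

lemma reach_step {w : Perm (Fin n)} {i j : Fin n} (hw : Reach (E h r) σ w) (hij : E h r i j) :
    Reach (E h r) σ (w * swap i j) := ReflTransGen.tail hw ⟨i, j, hij, rfl⟩

lemma swap_conj {i j k : Fin n} (hij : i ≠ j) (hik : i ≠ k) (hjk : j ≠ k) :
    swap i j = swap k i * swap k j * swap k i := by
  ext x
  simp only [Perm.mul_apply, swap_apply_def]
  split_ifs <;> simp_all

/-- The class `∑ κ i x_i`. -/
def xc (κ : Fin n → ℤ) : Perm (Fin n) → Fin n → ℤ := fun w x => κ (w.symm x)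

lemma xc_GA (κ : Fin n → ℤ) : GA h (xc κ) := by
  intro w i j _ _
  refine ⟨fun x h1 h2 => ?_, ?_⟩
  · change κ (swap i j (w.symm x)) = κ (w.symm x)
    rw [swap_apply_of_ne_of_ne]
    · rintro h3; exact h1 (by rw [← h3]; simp)
    · rintro h3; exact h2 (by rw [← h3]; simp)
  · change κ (swap i j (w.symm (w i))) + κ (swap i j (w.symm (w j)))
      = κ (w.symm (w i)) + κ (w.symm (w j))
    simp [add_comm]

lemma twin {g : Perm (Fin n) → Fin n → ℤ} (hg : GK h r σ g) (K : Fin n → Prop)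
    (hK : ∀ i j, K i → K j → i ≠ j → E h r i j)
    (hK2 : ∀ i j z, K i → K j → z ≠ j → E h r i z → E h r j z) :
    ∃ κ : Fin n → ℤ, (∀ i, ¬ K i → κ i = 0) ∧
      ∀ w, Reach (E h r) σ w → ∀ i j, K i → K j →
        (g + xc κ) (w * swap i j) = (g + xc κ) w := by
  classical
  by_cases hne : ∃ i0, K i0
  swap
  · exact ⟨0, fun _ _ => rfl, fun w _ i j hi => absurd ⟨i, hi⟩ hne⟩
  obtain ⟨i0, hi0⟩ := hne
  -- constancy of the coefficient
  have hstep1 : ∀ i j, K i → K j → i ≠ j → ∀ w, Reach (E h r) σ w → ∀ z, E h r z i →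
      cf g (w * swap z i) i j = cf g w i j := by
    intro i j hi hj hij w hw z hz
    by_cases hzj : z = j
    · subst hzj
      rw [swap_comm]
      exact cf_self (hg w hw _ _ hz.symm)
    · have hjz : E h r j z := hK2 i j z hi hj hzj hz.symm
      have hEij := hK i j hi hj hij
      exact cf_tri hz.ne hzj hij (hg w hw _ _ hz) (hg _ (reach_step hw hz) _ _ hEij)
        (hg _ (reach_step (reach_step hw hz) hEij) _ _ hjz.symm) (hg w hw _ _ hEij)
  have hstep2 : ∀ i j, K i → K j → i ≠ j → ∀ w, Reach (E h r) σ w → ∀ z, E h r z j →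
      cf g (w * swap z j) i j = cf g w i j := by
    intro i j hi hj hij w hw z hz
    have := hstep1 j i hj hi hij.symm w hw z hz
    rw [cf_symm (hg _ (reach_step hw hz) _ _ (hK i j hi hj hij)),
      cf_symm (hg _ hw _ _ (hK i j hi hj hij))] at this
    omega
  have hconst : ∀ i j, K i → K j → i ≠ j → ∀ w, Reach (E h r) σ w →
      cf g w i j = cf g σ i j := by
    intro i j hi hj hij w hw
    refine inv_of_reach (A := E h r) (B := E h r) (fun _ _ => id) (fun w => cf g w i j) ?_
      (.refl : Reach (E h r) σ σ) hw
    intro w hw k l hkl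
    by_cases h1 : i = k
    · subst h1; rw [swap_comm]; exact hstep1 i j hi hj hij w hw l hkl.symm
    by_cases h2 : i = l
    · subst h2; exact hstep1 i j hi hj hij w hw k hkl
    by_cases h3 : j = k
    · subst h3; rw [swap_comm]; exact hstep2 i j hi hj hij w hw l hkl.symm
    by_cases h4 : j = l
    · subst h4; exact hstep2 i j hi hj hij w hw k hkl
    exact cf_comm h1 h2 h3 h4 (hg w hw _ _ hkl)
      (hg _ (reach_step hw (hK i j hi hj hij)) _ _ hkl)
  set κ : Fin n → ℤ := fun i => if K i ∧ i ≠ i0 then cf g σ i0 i else 0 with hκ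
  refine ⟨κ, fun i hi => by simp [hκ, hi], ?_⟩
  have base : ∀ w, Reach (E h r) σ w → ∀ i, K i → i ≠ i0 →
      (g + xc κ) (w * swap i0 i) = (g + xc κ) w := by
    intro w hw i hi hii
    have hEC := hg w hw _ _ (hK i0 i hi0 hi hii.symm)
    have hc := hconst i0 i hi0 hi hii.symm w hw
    have k0 : κ i0 = 0 := by simp [hκ]
    have k1 : κ i = cf g w i0 i := by simp [hκ, hi, hii, hc]
    funext x
    have ex : (w * swap i0 i).symm x = swap i0 i (w.symm x) := rfl
    simp only [Pi.add_apply, xc, ex]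
    by_cases h1 : x = w i0
    · subst h1
      simp only [symm_apply_apply, swap_apply_left, k0, k1]
      unfold cf; omega
    by_cases h2 : x = w i
    · subst h2
      simp only [symm_apply_apply, swap_apply_right, k0, k1]
      have := hEC.2
      unfold cf; omega
    rw [hEC.1 x h1 h2, swap_apply_of_ne_of_ne]
    · rintro h3; exact h1 (by rw [← h3]; simp)
    · rintro h3; exact h2 (by rw [← h3]; simp)
  intro w hw i j hi hj
  by_cases hij : i = j
  · subst hij; rw [swap_self]; rfl
  by_cases h1 : i = i0
  · subst h1; exact base w hw j hj (Ne.symm hij)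
  by_cases h2 : j = i0
  · subst h2; rw [swap_comm]; exact base w hw i hi hij
  have r1 := reach_step hw (hK i0 i hi0 hi (Ne.symm h1))
  have r2 := reach_step r1 (hK i0 j hi0 hj (Ne.symm h2))
  rw [swap_conj hij h1 h2, ← mul_assoc, ← mul_assoc, base _ r2 i hi h1, base _ r1 j hj h2,
    base _ hw i hi h1]

end vec

section tstep
variable {n : ℕ} {h : Fin n → Fin n} {r : Fin n} {σ : Perm (Fin n)}

/-- Edges inside `≤ m` act trivially. -/
def State (h : Fin n → Fin n) (r : Fin n) (σ : Perm (Fin n)) (m : ℕ)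
    (g : Perm (Fin n) → Fin n → ℤ) : Prop :=
  ∀ w, Reach (E h r) σ w → ∀ i j, E h r i j → (i : ℕ) ≤ m → (j : ℕ) ≤ m → g (w * swap i j) = g w

/-- Positions `≤ t`, image. -/
def im (t : Fin n) (w : Perm (Fin n)) : Finset (Fin n) :=
  Finset.univ.filter (fun x => w.symm x ≤ t)

lemma im_swap {t : Fin n} {w : Perm (Fin n)} {i j : Fin n} (H : i ≤ t ↔ j ≤ t) :
    im t (w * swap i j) = im t w := by
  unfold im
  ext x
  have ex : (w * swap i j).symm x = swap i j (w.symm x) := rfl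
  simp only [Finset.mem_filter, Finset.mem_univ, true_and, ex]
  rw [swap_apply_def]
  split_ifs with h1 h2
  · rw [h1, H]
  · rw [h2, H]
  · rfl

/-- The bridge class. -/
def Tc (t t' : Fin n) (φ : Finset (Fin n) → ℤ) : Perm (Fin n) → Fin n → ℤ :=
  fun w x => φ (im t w) *
    ((if w.symm x = t then 1 else 0) - (if w.symm x = t' then 1 else 0))

lemma Tc_EC_of_same {t t' : Fin n} (φ : Finset (Fin n) → ℤ) {w : Perm (Fin n)} {i j : Fin n}
    (H : i ≤ t ↔ j ≤ t) : EC (Tc t t' φ) w i j := by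
  refine ⟨fun x h1 h2 => ?_, ?_⟩
  · have ex : (w * swap i j).symm x = swap i j (w.symm x) := rfl
    unfold Tc
    rw [im_swap H, ex, swap_apply_of_ne_of_ne]
    · rintro h3; exact h1 (by rw [← h3]; simp)
    · rintro h3; exact h2 (by rw [← h3]; simp)
  · have e1 : (w * swap i j).symm (w i) = j := by
      change swap i j (w.symm (w i)) = j; simp
    have e2 : (w * swap i j).symm (w j) = i := by
      change swap i j (w.symm (w j)) = i; simp
    unfold Tc
    rw [im_swap H, e1, e2]
    simp only [symm_apply_apply]
    ring

lemma Tc_EC_bridge {t t' : Fin n} (htt : t ≠ t') (φ : Finset (Fin n) → ℤ) {w : Perm (Fin n)} :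
    EC (Tc t t' φ) w t' t := by
  refine ⟨fun x h1 h2 => ?_, ?_⟩
  · have ex : (w * swap t' t).symm x = swap t' t (w.symm x) := rfl
    have n1 : w.symm x ≠ t' := by rintro h3; exact h1 (by rw [← h3]; simp)
    have n2 : w.symm x ≠ t := by rintro h3; exact h2 (by rw [← h3]; simp)
    unfold Tc
    rw [ex, swap_apply_of_ne_of_ne n1 n2]
    simp [n1, n2]
  · have e1 : (w * swap t' t).symm (w t') = t := by
      change swap t' t (w.symm (w t')) = t; simp
    have e2 : (w * swap t' t).symm (w t) = t' := by
      change swap t' t (w.symm (w t)) = t'; simp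
    unfold Tc
    rw [e1, e2]
    simp [htt, htt.symm]

lemma Tc_GA {t t' : Fin n} (htt : (t' : ℕ) = t + 1)
    (ht : ∀ i, i < t → h i ≤ t)
    (ht' : h t = t') (φ : Finset (Fin n) → ℤ) : GA h (Tc t t' φ) := by
  intro w i j hji hij
  by_cases hj : j < t
  · exact Tc_EC_of_same φ ⟨fun _ => hj.le, fun _ => hij.trans (ht j hj)⟩
  by_cases hj2 : j = t
  · subst hj2
    have : i = t' := by
      rw [ht'] at hij
      apply Fin.ext
      have h1 : (i:ℕ) ≤ t' := hij
      have h2 : (j:ℕ) < i := hji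
      omega
    subst this
    exact Tc_EC_bridge hji.ne φ
  · have : t < j := lt_of_le_of_ne (not_lt.mp hj) (Ne.symm hj2)
    exact Tc_EC_of_same φ ⟨fun h1 => absurd (this.trans hji) (not_lt.mpr h1),
      fun h1 => absurd this (not_lt.mpr h1)⟩

lemma GA.add {g g' : Perm (Fin n) → Fin n → ℤ} (H : GA h g) (H' : GA h g') : GA h (g + g') :=
  fun w i j h1 h2 => (H w i j h1 h2).add (H' w i j h1 h2)

lemma GA.neg {g : Perm (Fin n) → Fin n → ℤ} (H : GA h g) : GA h (-g) :=
  fun w i j h1 h2 => (H w i j h1 h2).neg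

lemma GK.add {g g' : Perm (Fin n) → Fin n → ℤ} (H : GK h r σ g) (H' : GK h r σ g') :
    GK h r σ (g + g') :=
  fun w hw i j h1 => (H w hw i j h1).add (H' w hw i j h1)

/-- Two reachable permutations with the same side-image are joined by edges respecting `P`. -/
lemma reach_sep (hmono : Monotone h) (hstep : ∀ i j : Fin n, (j : ℕ) = i + 1 → j ≤ h i)
    {t : Fin n} {w w' : Perm (Fin n)} (hw : Reach (E h r) σ w) (hw' : Reach (E h r) σ w')
    (him : im t w = im t w') :
    Reach (fun i j => E h r i j ∧ (i ≤ t ↔ j ≤ t)) w w' := by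
  have hww : Reach (E h r) w w' := (reach_symm hw).trans hw'
  have e : w' = w * (w⁻¹ * w') := by simp
  rw [e]
  refine reach_of_conn (fun i j hij => hij.1.ne) _ _ fun x => ?_
  have h1 : ReflTransGen (E h r) ((w⁻¹ * w') x) x :=
    conn_of_reach (fun i j hij => hij.symm) hww _ _ (by simp)
  have h1 := rtg_symm (fun i j hij => E.symm hij) h1
  have hiff : (w⁻¹ * w') x ≤ t ↔ x ≤ t := by
    have := Finset.ext_iff.mp him (w' x)
    simpa [im] using this
  by_cases hx : x ≤ t
  · refine rtg_mono ?_ (conv hmono hstep (P := fun y => y ≤ t)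
      (fun x y z _ h2 _ h4 => h4.trans h2) h1 hx (hiff.mpr hx))
    intro i j hij
    exact ⟨hij.1, ⟨fun _ => hij.2.2, fun _ => hij.2.1⟩⟩
  · refine rtg_mono ?_ (conv hmono hstep (P := fun y => ¬ y ≤ t)
      (fun x y z h1 _ h3 _ h5 => h1 (h3.trans h5)) h1 hx (fun h => hx (hiff.mp h)))
    intro i j hij
    exact ⟨hij.1, ⟨fun h => absurd h hij.2.1, fun h => absurd h hij.2.2⟩⟩

lemma tstep (hmono : Monotone h) (hstep : ∀ i j : Fin n, (j : ℕ) = i + 1 → j ≤ h i)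
    {g : Perm (Fin n) → Fin n → ℤ} (hg : GK h r σ g) {m : ℕ} (hS : State h r σ m g)
    {t t' : Fin n} (htm : (t : ℕ) = m + 1) (htt : (t' : ℕ) = t + 1)
    (ht : ∀ i, i < t → h i ≤ t) (ht' : h t = t') :
    ∃ G, GA h G ∧ State h r σ (m + 1) (g + G) := by
  classical
  have htt1 : t < t' := Fin.lt_def.mpr (by omega)
  by_cases hne : ∃ i0, i0 < t ∧ E h r i0 t
  swap
  · refine ⟨0, fun w i j _ _ => ⟨fun _ _ _ => rfl, rfl⟩, ?_⟩
    intro w hw i j hij hi hj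
    rw [add_zero]
    by_cases h1 : (i : ℕ) ≤ m
    · by_cases h2 : (j : ℕ) ≤ m
      · exact hS w hw i j hij h1 h2
      · have : j = t := Fin.ext (by omega)
        subst this
        exact absurd ⟨i, Fin.lt_def.mpr (by omega), hij⟩ hne
    · have : i = t := Fin.ext (by omega)
      subst this
      have := hij.ne
      exact absurd ⟨j, lt_of_le_of_ne (Fin.le_def.mpr (by omega)) this.symm, hij.symm⟩ hne
  obtain ⟨i0, hi0, hE0⟩ := hne
  have adj : ∀ u, u < t → u ≠ i0 → E h r u t → E h r u i0 := by
    intro u hu hui hut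
    refine ⟨hut.1, hE0.1, ?_⟩
    have a1 : t ≤ h u := by
      rcases hut.2.2 with h1 | h1
      · exact absurd h1.1 (not_lt.mpr hu.le)
      · exact h1.2
    have a2 : t ≤ h i0 := by
      rcases hE0.2.2 with h1 | h1
      · exact absurd h1.1 (not_lt.mpr hi0.le)
      · exact h1.2
    rcases lt_or_gt_of_ne hui with h1 | h1
    · exact Or.inr ⟨h1, hi0.le.trans a1⟩
    · exact Or.inl ⟨h1, hu.le.trans a2⟩
  have lem : ∀ i : Fin n, i < t → (i : ℕ) ≤ m := fun i hi => by
    have := Fin.lt_def.mp hi; omega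
  -- invariance under `{u, i0}`
  have inv1 : ∀ w, Reach (E h r) σ w → ∀ u, u < t → E h r u i0 →
      cf g (w * swap u i0) i0 t = cf g w i0 t := by
    intro w hw u hu hui
    have r1 := reach_step hw hui
    have r2 := reach_step hw hE0
    exact cf_hex hui.ne hu.ne hi0.ne (hS w hw _ _ hui (lem _ hu) (lem _ hi0))
      (hS _ r2 _ _ hui (lem _ hu) (lem _ hi0))
      (hS _ (reach_step r1 hE0) _ _ hui (lem _ hu) (lem _ hi0))
      (hg w hw _ _ hE0) (hg _ r1 _ _ hE0) (hg _ (reach_step r2 hui) _ _ hE0)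
  have inv2 : ∀ w, Reach (E h r) σ w → ∀ u, u < t → E h r u t →
      cf g (w * swap u t) i0 t = cf g w i0 t := by
    intro w hw u hu hut
    by_cases hui : u = i0
    · subst hui; exact cf_self (hg w hw _ _ hut)
    have hE := adj u hu hui hut
    have r1 := reach_step hw hE
    have r2 := reach_step r1 hE0
    rw [swap_conj hut.ne hui hi0.ne', swap_comm i0 u, ← mul_assoc, ← mul_assoc,
      inv1 _ r2 u hu hE, cf_self (hg _ r1 _ _ hE0), inv1 _ hw u hu hE]
  have inv3 : ∀ w, Reach (E h r) σ w → ∀ i j, E h r i j → i < j → (i ≤ t ↔ j ≤ t) →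
      cf g (w * swap i j) i0 t = cf g w i0 t := by
    intro w hw i j hij hlt hiff
    by_cases h1 : i ≤ t
    · have h2 := hiff.mp h1
      have h3 : i < t := lt_of_lt_of_le hlt h2
      by_cases h4 : j = t
      · subst h4; exact inv2 w hw i h3 hij
      have h5 : j < t := lt_of_le_of_ne h2 h4
      by_cases h6 : j = i0
      · subst h6; exact inv1 w hw i h3 hij
      by_cases h7 : i = i0
      · subst h7; rw [swap_comm]; exact inv1 w hw j h5 hij.symm
      exact cf_comm (Ne.symm h7) (Ne.symm h6) h3.ne' (Ne.symm h4) (hg w hw _ _ hij)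
        (hg _ (reach_step hw hE0) _ _ hij)
    · have h2 : ¬ j ≤ t := fun h => h1 (hiff.mpr h)
      rw [not_le] at h1 h2
      exact cf_comm (hi0.trans h1).ne (hi0.trans h2).ne h1.ne h2.ne (hg w hw _ _ hij)
        (hg _ (reach_step hw hE0) _ _ hij)
  have const : ∀ w w', Reach (E h r) σ w → Reach (E h r) σ w' → im t w = im t w' →
      cf g w' i0 t = cf g w i0 t := by
    intro w w' hw hw' him
    refine inv_of_reach (A := fun i j => E h r i j ∧ (i ≤ t ↔ j ≤ t)) (B := E h r) (σ := σ)
      (fun _ _ H => H.1) (fun w => cf g w i0 t) ?_ hw (reach_sep hmono hstep hw hw' him)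
    intro w hw i j ⟨hij, hiff⟩
    rcases lt_or_gt_of_ne hij.ne with h1 | h1
    · exact inv3 w hw i j hij h1 hiff
    · rw [swap_comm]; exact inv3 w hw j i hij.symm h1 hiff.symm
  set φ : Finset (Fin n) → ℤ := fun S =>
    if H : ∃ w, Reach (E h r) σ w ∧ im t w = S then cf g H.choose i0 t else 0 with hφ
  have hφc : ∀ w, Reach (E h r) σ w → φ (im t w) = cf g w i0 t := by
    intro w hw
    have H : ∃ w', Reach (E h r) σ w' ∧ im t w' = im t w := ⟨w, hw, rfl⟩
    simp only [hφ]
    rw [dif_pos H]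
    exact const _ _ hw H.choose_spec.1 H.choose_spec.2.symm
  refine ⟨Tc t t' φ, Tc_GA htt ht ht' φ, ?_⟩
  have low : ∀ w, Reach (E h r) σ w → ∀ i j, E h r i j → i < t → j < t →
      (g + Tc t t' φ) (w * swap i j) = (g + Tc t t' φ) w := by
    intro w hw i j hij hi hj
    funext x
    have ex : (w * swap i j).symm x = swap i j (w.symm x) := rfl
    simp only [Pi.add_apply, Tc]
    rw [hS w hw i j hij (lem _ hi) (lem _ hj), im_swap (by simp [hi.le, hj.le]), ex]
    have q : ∀ s, t ≤ s → (swap i j (w.symm x) = s ↔ w.symm x = s) := by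
      intro s hs
      rw [swap_apply_eq_iff, swap_apply_of_ne_of_ne (hi.trans_le hs).ne' (hj.trans_le hs).ne']
    simp only [q t le_rfl, q t' htt1.le]
  have main0 : ∀ w, Reach (E h r) σ w →
      (g + Tc t t' φ) (w * swap i0 t) = (g + Tc t t' φ) w := by
    intro w hw
    have hEC := hg w hw _ _ hE0
    have hc := hφc w hw
    have n1 : i0 ≠ t := hi0.ne
    have n2 : i0 ≠ t' := (hi0.trans htt1).ne
    have n3 : t ≠ t' := htt1.ne
    funext x
    have ex : (w * swap i0 t).symm x = swap i0 t (w.symm x) := rfl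
    simp only [Pi.add_apply, Tc]
    rw [im_swap (by simp [hi0.le]), ex, hc]
    unfold cf
    by_cases h1 : x = w i0
    · subst h1
      simp [n1, n2, n3]
    by_cases h2 : x = w t
    · subst h2
      simp [n1, n2, n3]
      have := hEC.2
      omega
    rw [hEC.1 x h1 h2, swap_apply_of_ne_of_ne]
    · rintro h3; exact h1 (by rw [← h3]; simp)
    · rintro h3; exact h2 (by rw [← h3]; simp)
  have main : ∀ w, Reach (E h r) σ w → ∀ u, u < t → E h r u t →
      (g + Tc t t' φ) (w * swap u t) = (g + Tc t t' φ) w := by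
    intro w hw u hu hut
    by_cases hui : u = i0
    · subst hui; exact main0 w hw
    have hE := adj u hu hui hut
    have r1 := reach_step hw hE
    have r2 := reach_step r1 hE0
    rw [swap_conj hut.ne hui hi0.ne', swap_comm i0 u, ← mul_assoc, ← mul_assoc,
      low _ r2 u i0 hE hu hi0, main0 _ r1, low _ hw u i0 hE hu hi0]
  intro w hw i j hij hi hj
  have hi' : i ≤ t := Fin.le_def.mpr (by omega)
  have hj' : j ≤ t := Fin.le_def.mpr (by omega)
  rcases lt_or_eq_of_le hi' with h1 | h1
  · rcases lt_or_eq_of_le hj' with h2 | h2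
    · exact low w hw i j hij h1 h2
    · subst h2; exact main w hw i h1 hij
  · subst h1
    rw [swap_comm]
    exact main w hw j (lt_of_le_of_ne hj' hij.ne.symm) hij.symm

end tstep

section side
variable {n : ℕ} {h : Fin n → Fin n} {r : Fin n} {σ : Perm (Fin n)}

lemma side (hmono : Monotone h) (hstep : ∀ i j : Fin n, (j : ℕ) = i + 1 → j ≤ h i)
    {g : Perm (Fin n) → Fin n → ℤ} (hg : GK h r σ g)
    {P : Fin n → Prop} (hP : ∀ x y z, P x → P y → x ≤ z → z ≤ y → P z)
    (hinv : ∀ w, Reach (E h r) σ w → ∀ i j, E h r i j → P i → P j → g (w * swap i j) = g w)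
    (hext : ∀ x, P x → ∃ (x1 : Fin n) (Q : Fin n → Prop), P x1 ∧ ReflTransGen (E h r) x x1 ∧
      (∀ x y z, Q x → Q y → x ≤ z → z ≤ y → Q z) ∧ ¬ Q x1 ∧
      ∀ y, ReflTransGen (E h r) x1 y → y ≠ x1 → Q y)
    {w w' : Perm (Fin n)} (hw : Reach (E h r) σ w) (hw' : Reach (E h r) σ w') {k : Fin n}
    (hk : P (w.symm k)) (hk' : P (w'.symm k)) : g w' k = g w k := by
  classical
  obtain ⟨x1, Q, hx1, hR, hQ, hQ1, hQ2⟩ := hext _ hk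
  -- move `k` to `x1`
  have move : ∀ w, Reach (E h r) σ w → P (w.symm k) → ReflTransGen (E h r) (w.symm k) x1 →
      ∃ v, Reach (E h r) σ v ∧ v x1 = k ∧ g v = g w := by
    intro w hw hk hR
    have hc := conv hmono hstep hP hR hk hx1
    have hc' : ReflTransGen (fun i j => E h r i j ∧ P i ∧ P j) x1 (w.symm k) :=
      rtg_symm (fun i j H => ⟨H.1.symm, H.2.2, H.2.1⟩) hc
    have hr : Reach (fun i j => E h r i j ∧ P i ∧ P j) w (w * swap (w.symm k) x1) := by
      refine reach_of_conn (fun i j hij => hij.1.ne) _ _ fun x => ?_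
      rw [swap_apply_def]
      split_ifs with h1 h2
      · rw [h1]; exact hc
      · rw [h2]; exact hc'
      · exact .refl
    refine ⟨w * swap (w.symm k) x1, hw.trans (reach_mono (fun i j H => H.1) hr), by simp, ?_⟩
    exact inv_of_reach (A := fun i j => E h r i j ∧ P i ∧ P j) (B := E h r) (σ := σ)
      (fun _ _ H => H.1) g (fun w hw i j H => hinv w hw i j H.1 H.2.1 H.2.2) hw hr
  have hR' : ReflTransGen (E h r) (w'.symm k) x1 := by
    refine ReflTransGen.trans ?_ hR
    exact conn_of_reach (fun i j hij => hij.symm) ((reach_symm hw').trans hw) _ _ (by simp)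
  obtain ⟨v, hv, hvk, hgv⟩ := move w hw hk hR
  obtain ⟨v', hv', hvk', hgv'⟩ := move w' hw' hk' hR'
  rw [← hgv, ← hgv']
  have hvv : Reach (E h r) v v' := (reach_symm hv).trans hv'
  have hr : Reach (fun i j => E h r i j ∧ i ≠ x1 ∧ j ≠ x1) v v' := by
    have e : v' = v * (v⁻¹ * v') := by simp
    rw [e]
    refine reach_of_conn (fun i j hij => hij.1.ne) _ _ fun x => ?_
    have fx : (v⁻¹ * v') x1 = x1 := by
      rw [Perm.mul_apply, hvk', ← hvk]; simp
    by_cases hx : x = x1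
    · rw [hx, fx]
    have hx' : (v⁻¹ * v') x ≠ x1 := fun h1 => hx ((v⁻¹ * v').injective (h1.trans fx.symm))
    have h1 : ReflTransGen (E h r) ((v⁻¹ * v') x) x :=
      conn_of_reach (fun i j hij => hij.symm) hvv _ _ (by simp)
    exact avoid hmono hstep hQ hQ1 hQ2 (rtg_symm (fun i j hij => E.symm hij) h1) hx hx'
  have := inv_of_reach (A := fun i j => E h r i j ∧ i ≠ x1 ∧ j ≠ x1) (B := E h r) (σ := σ)
      (fun _ _ H => H.1) (fun w => if w x1 = k then g w k else 0) ?_ hv hr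
  · simpa [hvk, hvk'] using this
  intro w hw i j ⟨hij, hi, hj⟩
  have e : (w * swap i j) x1 = w x1 := by
    simp [swap_apply_of_ne_of_ne (Ne.symm hi) (Ne.symm hj)]
  rw [e]
  split_ifs with h1
  · subst h1
    exact (hg w hw i j hij).1 _ (by simpa using Ne.symm hi) (by simpa using Ne.symm hj)
  · rfl

lemma ext_min (b : Fin n) (x : Fin n) (hx : x < b) :
    ∃ (x1 : Fin n) (Q : Fin n → Prop), x1 < b ∧ ReflTransGen (E h r) x x1 ∧
      (∀ x y z, Q x → Q y → x ≤ z → z ≤ y → Q z) ∧ ¬ Q x1 ∧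
      ∀ y, ReflTransGen (E h r) x1 y → y ≠ x1 → Q y := by
  classical
  obtain ⟨x1, h1, h2⟩ := Finset.exists_min_image
    (Finset.univ.filter (fun y => ReflTransGen (E h r) x y)) id ⟨x, by simp [ReflTransGen.refl]⟩
  simp only [Finset.mem_filter, Finset.mem_univ, true_and, id] at h1 h2
  refine ⟨x1, fun y => x1 < y, (h2 x .refl).trans_lt hx, h1,
    fun x y z a _ c _ => lt_of_lt_of_le a c, lt_irrefl _, fun y hy hne => ?_⟩
  exact lt_of_le_of_ne (h2 y (h1.trans hy)) hne.symm

lemma ext_max (b : Fin n) (x : Fin n) (hx : b < x) :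
    ∃ (x1 : Fin n) (Q : Fin n → Prop), b < x1 ∧ ReflTransGen (E h r) x x1 ∧
      (∀ x y z, Q x → Q y → x ≤ z → z ≤ y → Q z) ∧ ¬ Q x1 ∧
      ∀ y, ReflTransGen (E h r) x1 y → y ≠ x1 → Q y := by
  classical
  obtain ⟨x1, h1, h2⟩ := Finset.exists_max_image
    (Finset.univ.filter (fun y => ReflTransGen (E h r) x y)) id ⟨x, by simp [ReflTransGen.refl]⟩
  simp only [Finset.mem_filter, Finset.mem_univ, true_and, id] at h1 h2
  refine ⟨x1, fun y => y < x1, hx.trans_le (h2 x .refl), h1,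
    fun x y z _ a _ c => lt_of_le_of_lt c a, lt_irrefl _, fun y hy hne => ?_⟩
  exact lt_of_le_of_ne (h2 y (h1.trans hy)) hne

lemma choose_const {p : Perm (Fin n) → Prop} {g : Perm (Fin n) → Fin n → ℤ} {k : Fin n}
    (H : ∀ w w', p w → p w' → g w' k = g w k) : ∃ α, ∀ w, p w → g w k = α := by
  by_cases h1 : ∃ w, p w
  · obtain ⟨w, hw⟩ := h1
    exact ⟨g w k, fun w' hw' => H w w' hw hw'⟩
  · exact ⟨0, fun w hw => absurd ⟨w, hw⟩ h1⟩

/-- Coordinates off the cut. -/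
def mm (b : Fin n) (α β : Fin n → ℤ) (w : Perm (Fin n)) (x : Fin n) : ℤ :=
  if w.symm x < b then α x else if b < w.symm x then β x else 0

/-- The cut class. -/
def Zc (b : Fin n) (α β : Fin n → ℤ) (K : ℤ) (w : Perm (Fin n)) (x : Fin n) : ℤ :=
  if w.symm x = b then K - ∑ y, mm b α β w y else mm b α β w x

lemma Zc_sum (b : Fin n) (α β : Fin n → ℤ) (K : ℤ) (w : Perm (Fin n)) :
    ∑ x, Zc b α β K w x = K := by
  have e : ∀ x, Zc b α β K w x =
      (if x = w b then K - ∑ y, mm b α β w y else 0) + mm b α β w x := by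
    intro x
    unfold Zc
    by_cases h1 : x = w b
    · subst h1; simp [mm]
    · have : w.symm x ≠ b := fun h2 => h1 (by rw [← h2]; simp)
      simp [h1, this]
  simp only [e, Finset.sum_add_distrib]
  simp

lemma Zc_GA {b : Fin n} (hb : ∀ j, j < b → h j ≤ b) (α β : Fin n → ℤ) (K : ℤ) :
    GA h (Zc b α β K) := by
  intro w i j hji hij
  have hoff : ∀ x, x ≠ w i → x ≠ w j → Zc b α β K (w * swap i j) x = Zc b α β K w x := by
    intro x h1 h2
    have n1 : w.symm x ≠ i := by rintro h3; exact h1 (by rw [← h3]; simp)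
    have n2 : w.symm x ≠ j := by rintro h3; exact h2 (by rw [← h3]; simp)
    have e : ∀ y, y ≠ w i → y ≠ w j → mm b α β (w * swap i j) y = mm b α β w y := by
      intro y h1 h2
      have n1 : w.symm y ≠ i := by rintro h3; exact h1 (by rw [← h3]; simp)
      have n2 : w.symm y ≠ j := by rintro h3; exact h2 (by rw [← h3]; simp)
      have ey : (w * swap i j).symm y = swap i j (w.symm y) := rfl
      unfold mm
      rw [ey, swap_apply_of_ne_of_ne n1 n2]
    have ex : (w * swap i j).symm x = swap i j (w.symm x) := rfl
    unfold Zc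
    rw [ex, swap_apply_of_ne_of_ne n1 n2, e x h1 h2]
    split_ifs with hxb
    · -- the moved positions lie on one side
      have hside : (i < b ∧ j < b) ∨ (b < i ∧ b < j) := by
        have m1 : i ≠ b := fun h => n1 (hxb.trans h.symm)
        have m2 : j ≠ b := fun h => n2 (hxb.trans h.symm)
        rcases lt_or_gt_of_ne m2 with h3 | h3
        · exact Or.inl ⟨lt_of_le_of_ne (hij.trans (hb j h3)) m1, h3⟩
        · exact Or.inr ⟨h3.trans hji, h3⟩
      congr 1
      refine Finset.sum_congr rfl fun y _ => ?_
      have ey : (w * swap i j).symm y = swap i j (w.symm y) := rfl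
      unfold mm
      rw [ey, swap_apply_def]
      split_ifs <;> first | rfl | (exfalso; omega)
    · rfl
  refine ⟨hoff, ?_⟩
  have := total_of_pair (p := w i) (q := w j) (by simpa using hji.ne') hoff
  rw [Zc_sum, Zc_sum] at this
  omega

lemma final (hmono : Monotone h) (hstep : ∀ i j : Fin n, (j : ℕ) = i + 1 → j ≤ h i)
    {g : Perm (Fin n) → Fin n → ℤ} (hg : GK h r σ g) {b : Fin n} (hb : ∀ j, j < b → h j ≤ b)
    (hl : ∀ w, Reach (E h r) σ w → ∀ i j, E h r i j → i < b → j < b → g (w * swap i j) = g w)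
    (hu : ∀ w, Reach (E h r) σ w → ∀ i j, E h r i j → b < i → b < j → g (w * swap i j) = g w) :
    ∃ G, GA h G ∧ ∀ w, Reach (E h r) σ w → G w = g w := by
  have hα : ∀ k, ∃ α, ∀ w, (Reach (E h r) σ w ∧ w.symm k < b) → g w k = α := fun k =>
    choose_const fun w w' h1 h2 => side hmono hstep hg (P := fun y => y < b)
      (fun x y z _ h2 _ h4 => lt_of_le_of_lt h4 h2) hl (fun x hx => ext_min b x hx)
      h1.1 h2.1 h1.2 h2.2
  have hβ : ∀ k, ∃ β, ∀ w, (Reach (E h r) σ w ∧ b < w.symm k) → g w k = β := fun k =>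
    choose_const fun w w' h1 h2 => side hmono hstep hg (P := fun y => b < y)
      (fun x y z h1 _ h3 _ => lt_of_lt_of_le h1 h3) hu (fun x hx => ext_max b x hx)
      h1.1 h2.1 h1.2 h2.2
  choose α hα using hα
  choose β hβ using hβ
  have hsum : ∀ w, Reach (E h r) σ w → ∑ x, g w x = ∑ x, g σ x := by
    intro w hw
    refine inv_of_reach (A := E h r) (B := E h r) (fun _ _ => id) (fun w => ∑ x, g w x) ?_
      (.refl : Reach (E h r) σ σ) hw
    intro w hw i j hij
    have H := hg w hw i j hij
    have := total_of_pair (p := w i) (q := w j) (by simpa using hij.ne) H.1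
    have := H.2
    omega
  refine ⟨Zc b α β (∑ x, g σ x), Zc_GA hb α β _, fun w hw => ?_⟩
  have hoff : ∀ x, x ≠ w b → Zc b α β (∑ x, g σ x) w x = g w x := by
    intro x hx
    have : w.symm x ≠ b := fun h2 => hx (by rw [← h2]; simp)
    unfold Zc mm
    rw [if_neg this]
    split_ifs with h1 h2
    · exact (hα x w ⟨hw, h1⟩).symm
    · exact (hβ x w ⟨hw, h2⟩).symm
    · exact absurd (lt_or_gt_of_ne this) (by tauto)
  have e := Zc_sum b α β (∑ x, g σ x) w
  rw [← hsum w hw, ← sub_eq_zero, ← Finset.sum_sub_distrib,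
    Finset.sum_eq_single (w b)] at e
  · funext x
    by_cases hx : x = w b
    · subst hx; rw [hsum w hw] at e; exact sub_eq_zero.mp e
    · exact hoff x hx
  · intro x _ hx; rw [hsum w hw, hoff x hx, sub_self]
  · intro h1; exact absurd (Finset.mem_univ _) h1

end side

section vecmain
variable {n : ℕ} {h : Fin n → Fin n} {r : Fin n} {σ : Perm (Fin n)}

lemma tsteps (hmono : Monotone h) (hstep : ∀ i j : Fin n, (j : ℕ) = i + 1 → j ≤ h i)
    {a b : ℕ} (hbn : b ≤ n - 1)
    (h1 : ∀ j : Fin n, (j : ℕ) ≤ a → (h j : ℕ) = a + 1)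
    (h2 : ∀ j : Fin n, a < (j : ℕ) → (j : ℕ) < b → (h j : ℕ) = (j : ℕ) + 1)
    {g : Perm (Fin n) → Fin n → ℤ} (hg : GK h r σ g) (hS : State h r σ a g) (d : ℕ)
    (hd : a + d < b) :
    ∃ G, GA h G ∧ State h r σ (a + d) (g + G) := by
  induction d with
  | zero => exact ⟨0, fun w i j _ _ => ⟨fun _ _ _ => rfl, rfl⟩, by simpa using hS⟩
  | succ d ih =>
    obtain ⟨G, hG, hSG⟩ := ih (by omega)
    obtain ⟨G', hG', hSG'⟩ := tstep hmono hstep (hg.add hG.gk) hSG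
      (t := ⟨a + d + 1, by omega⟩) (t' := ⟨a + d + 2, by omega⟩) rfl rfl
      (by
        intro i hi
        have hi : (i : ℕ) < a + d + 1 := hi
        refine Fin.le_def.mpr ?_
        change (h i : ℕ) ≤ a + d + 1
        by_cases hia : (i : ℕ) ≤ a
        · rw [h1 i hia]; omega
        · rw [h2 i (by omega) (by omega)]; omega)
      (by
        apply Fin.ext
        rw [h2 _ (by simp only; omega) (by simp only; omega)])
    exact ⟨G + G', hG.add hG', by rw [← add_assoc, ← add_assoc]; exact hSG'⟩

lemma vec_main (hmono : Monotone h) (hlol : Lollipop h)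
    {g : Perm (Fin n) → Fin n → ℤ} (hg : GK h r σ g) :
    ∃ G, GA h G ∧ ∀ w, Reach (E h r) σ w → G w = g w := by
  obtain ⟨a, b, hab, hbn, h1, h2, h3⟩ := hlol
  have hn : 0 < n := r.pos
  have hstep : ∀ i j : Fin n, (j : ℕ) = i + 1 → j ≤ h i := by
    intro i j hij
    refine Fin.le_def.mpr ?_
    by_cases c1 : (i : ℕ) ≤ a
    · rw [h1 i c1]; omega
    by_cases c2 : (i : ℕ) < b
    · rw [h2 i (by omega) c2]; omega
    · rw [h3 i (by omega)]; omega
  have hE : ∀ i j : Fin n, i ≠ r → j ≠ r → i ≠ j →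
      ((i : ℕ) ≤ j → (j : ℕ) ≤ h i) → ((j : ℕ) ≤ i → (i : ℕ) ≤ h j) → E h r i j := by
    intro i j hi hj hij c1 c2
    refine ⟨hi, hj, ?_⟩
    rcases lt_or_gt_of_ne hij with c | c
    · exact Or.inr ⟨c, Fin.le_def.mpr (c1 (Fin.le_def.mp c.le))⟩
    · exact Or.inl ⟨c, Fin.le_def.mpr (c2 (Fin.le_def.mp c.le))⟩
  have hE2 : ∀ i j : Fin n, E h r i j → ((i : ℕ) ≤ j → (j : ℕ) ≤ h i) ∧
      ((j : ℕ) ≤ i → (i : ℕ) ≤ h j) := by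
    intro i j hij
    rcases hij.2.2 with ⟨c, c'⟩ | ⟨c, c'⟩ <;> rw [Fin.lt_def] at c <;> rw [Fin.le_def] at c' <;>
      constructor <;> intro _ <;> omega
  -- left twin
  obtain ⟨κ1, -, hκ1⟩ := twin hg (fun i => (i : ℕ) ≤ a ∧ i ≠ r)
    (by
      rintro i j ⟨hi, hi'⟩ ⟨hj, hj'⟩ hij
      refine hE i j hi' hj' hij (fun _ => ?_) (fun _ => ?_)
      · rw [h1 i hi]; omega
      · rw [h1 j hj]; omega)
    (by
      rintro i j z ⟨hi, hi'⟩ ⟨hj, hj'⟩ hz hiz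
      have hz2 := hE2 _ _ hiz
      rw [h1 i hi] at hz2
      refine hE j z hj' hiz.2.1 hz.symm (fun _ => ?_) (fun _ => ?_)
      · rw [h1 j hj]; omega
      · rw [h1 z (by omega)]; omega)
  have hS : State h r σ a (g + xc κ1) := fun w hw i j hij hi hj =>
    hκ1 w hw i j ⟨hi, hij.1⟩ ⟨hj, hij.2.1⟩
  have hg1 : GK h r σ (g + xc κ1) := hg.add (xc_GA κ1).gk
  obtain ⟨G, hG, hSG⟩ := tsteps hmono hstep hbn h1 h2 hg1 hS (b - 1 - a) (by omega)
  have hg2 : GK h r σ (g + xc κ1 + G) := hg1.add hG.gk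
  -- right twin
  obtain ⟨κ2, hκ0, hκ2⟩ := twin hg2 (fun i => b < (i : ℕ) ∧ i ≠ r)
    (by
      rintro i j ⟨hi, hi'⟩ ⟨hj, hj'⟩ hij
      refine hE i j hi' hj' hij (fun _ => ?_) (fun _ => ?_)
      · rw [h3 i (by omega)]; omega
      · rw [h3 j (by omega)]; omega)
    (by
      rintro i j z ⟨hi, hi'⟩ ⟨hj, hj'⟩ hz hiz
      have hz2 := (hE2 _ _ hiz).2
      have hzb : b ≤ (z : ℕ) := by
        by_contra hc
        have := hz2 (by omega)
        by_cases c1 : (z : ℕ) ≤ a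
        · rw [h1 z c1] at this; omega
        · rw [h2 z (by omega) (by omega)] at this; omega
      refine hE j z hj' hiz.2.1 hz.symm (fun _ => ?_) (fun _ => ?_)
      · rw [h3 j (by omega)]; omega
      · rw [h3 z (by omega)]; omega)
  have hg3 : GK h r σ (g + xc κ1 + G + xc κ2) := hg2.add (xc_GA κ2).gk
  obtain ⟨Z, hZ, hZe⟩ := final hmono hstep hg3 (b := ⟨b, by omega⟩)
    (by
      intro j hj
      have hj : (j : ℕ) < b := hj
      refine Fin.le_def.mpr ?_
      change (h j : ℕ) ≤ b
      by_cases c1 : (j : ℕ) ≤ a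
      · rw [h1 j c1]; omega
      · rw [h2 j (by omega) hj]; omega)
    (by
      intro w hw i j hij hi hj
      have hi : (i : ℕ) < b := hi
      have hj : (j : ℕ) < b := hj
      have e1 := hSG w hw i j hij (by omega) (by omega)
      have e2 : xc κ2 (w * swap i j) = xc κ2 w := by
        funext x
        change κ2 (swap i j (w.symm x)) = κ2 (w.symm x)
        rw [swap_apply_def]
        split_ifs with c1 c2
        · rw [c1, hκ0 i (by omega), hκ0 j (by omega)]
        · rw [c2, hκ0 i (by omega), hκ0 j (by omega)]
        · rfl
      rw [Pi.add_apply, Pi.add_apply (g + xc κ1 + G), e1, e2])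
    (fun w hw i j hij hi hj => hκ2 w hw i j ⟨hi, hij.1⟩ ⟨hj, hij.2.1⟩)
  refine ⟨Z + (-(xc κ1) + -G + -(xc κ2)),
    hZ.add (((xc_GA κ1).neg.add hG.neg).add (xc_GA κ2).neg), fun w hw => ?_⟩
  rw [Pi.add_apply, hZe w hw]
  funext x
  simp only [Pi.add_apply, Pi.neg_apply]
  ring

end vecmain

section convert
variable {n : ℕ} {h : Fin n → Fin n} {r : Fin n} {σ : Perm (Fin n)}

lemma mem_component_iff (hσ : (σ r : ℕ) = n - 1) (w : Perm (Fin n)) :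
    w ∈ component h r σ ↔ Reach (E h r) σ w := by
  constructor
  · intro H
    refine rtg_mono ?_ H
    rintro u v ⟨h1, h2, i, j, hji, hij, rfl⟩
    have key : swap i j r = r := by
      apply u.injective
      apply Fin.ext
      rw [h1]; exact h2
    refine ⟨i, j, ⟨?_, ?_, Or.inl ⟨hji, hij⟩⟩, rfl⟩
    · rintro rfl; rw [swap_apply_left] at key; exact hji.ne key
    · rintro rfl; rw [swap_apply_right] at key; exact hji.ne key.symm
  · intro H
    have : (w r : ℕ) = n - 1 ∧ w ∈ component h r σ := by
      induction H with
      | refl => exact ⟨hσ, ReflTransGen.refl⟩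
      | @tail u v _ h2 ih =>
        obtain ⟨i, j, hij, rfl⟩ := h2
        have e : (u * swap i j) r = u r := by
          rw [Perm.mul_apply, swap_apply_of_ne_of_ne hij.1.symm hij.2.1.symm]
        refine ⟨by rw [e]; exact ih.1, ReflTransGen.tail ih.2 ⟨ih.1, by rw [e]; exact ih.1, ?_⟩⟩
        rcases hij.2.2 with c | c
        · exact ⟨i, j, c.1, c.2, rfl⟩
        · exact ⟨j, i, c.1, c.2, by rw [swap_comm]⟩
    exact this.2

/-- Linear coefficient. -/
noncomputable def lc (p : MvPolynomial (Fin n) ℤ) (x : Fin n) : ℤ :=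
  coeff (Finsupp.single x 1) p

lemma lc_mul_X (q : MvPolynomial (Fin n) ℤ) (a x : Fin n) :
    lc (q * X a) x = if x = a then coeff 0 q else 0 := by
  classical
  unfold lc
  rw [coeff_mul_X']
  by_cases h1 : x = a
  · subst h1; simp
  · have h2 : a ≠ x := fun h3 => h1 h3.symm
    simp [h1, h2]

lemma lc_of_mem {p : MvPolynomial (Fin n) ℤ} {a b : Fin n} (hab : a ≠ b)
    (H : p ∈ Ideal.span {(X a - X b : MvPolynomial (Fin n) ℤ)}) :
    (∀ x, x ≠ a → x ≠ b → lc p x = 0) ∧ lc p a + lc p b = 0 := by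
  obtain ⟨q, rfl⟩ := Ideal.mem_span_singleton'.mp H
  have e : ∀ x, lc (q * (X a - X b)) x =
      (if x = a then coeff 0 q else 0) - (if x = b then coeff 0 q else 0) := by
    intro x
    rw [← lc_mul_X, ← lc_mul_X, mul_sub]
    exact coeff_sub _ _ _ _
  refine ⟨fun x h1 h2 => by rw [e]; simp [h1, h2], ?_⟩
  rw [e, e]
  simp [hab, hab.symm]

/-- The linear form with given coefficients. -/
noncomputable def lf (v : Fin n → ℤ) : MvPolynomial (Fin n) ℤ := ∑ k, C (v k) * X k

lemma lf_hom (v : Fin n → ℤ) : (lf v).IsHomogeneous 1 := by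
  refine IsHomogeneous.sum _ _ _ fun k _ => ?_
  have := (isHomogeneous_C (Fin n) (v k)).mul (isHomogeneous_X ℤ k)
  simpa using this

lemma lc_lf (v : Fin n → ℤ) (x : Fin n) : lc (lf v) x = v x := by
  have : lc (lf v) x = ∑ k, lc (C (v k) * X k) x := by
    unfold lc lf; exact coeff_sum _ _ _
  rw [this]
  simp only [lc_mul_X, coeff_zero_C]
  simp

lemma hom_ext {p q : MvPolynomial (Fin n) ℤ} (hp : p.IsHomogeneous 1) (hq : q.IsHomogeneous 1)
    (H : ∀ x, lc p x = lc q x) : p = q := by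
  ext m
  by_cases hm : Finsupp.degree m = 1
  · obtain ⟨x, rfl⟩ : ∃ x, m = Finsupp.single x 1 := by
      exact (Finsupp.sum_eq_one_iff m).mp hm
    exact H x
  · rw [hp.coeff_eq_zero hm, hq.coeff_eq_zero hm]

lemma lf_mem {u v : Fin n → ℤ} {a b : Fin n} (hab : a ≠ b)
    (hoff : ∀ x, x ≠ a → x ≠ b → v x = u x) (hs : v a + v b = u a + u b) :
    lf u - lf v ∈ Ideal.span {(X a - X b : MvPolynomial (Fin n) ℤ)} := by
  refine Ideal.mem_span_singleton'.mpr ⟨C (u a - v a), ?_⟩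
  unfold lf
  rw [← Finset.sum_sub_distrib, Finset.sum_eq_add a b hab]
  · have : u b - v b = - (u a - v a) := by omega
    rw [← sub_mul, ← sub_mul, ← C_sub, ← C_sub, this, C_neg]
    ring
  · rintro c - ⟨h1, h2⟩; rw [hoff c h1 h2, sub_self]
  · intro h; exact absurd (Finset.mem_univ _) h
  · intro h; exact absurd (Finset.mem_univ _) h

theorem main_aux (hmono : Monotone h) (hlol : Lollipop h) (hσ : (σ r : ℕ) = n - 1)
    (f : Perm (Fin n) → MvPolynomial (Fin n) ℤ)
    (hf : ∀ w ∈ component h r σ, ∀ i j : Fin n, j < i → i ≤ h j →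
      w * swap i j ∈ component h r σ →
      f w - f (w * swap i j) ∈ Ideal.span {X (w i) - X (w j)})
    (hdeg : ∀ w ∈ component h r σ, (f w).IsHomogeneous 1) :
    ∃ F : Perm (Fin n) → MvPolynomial (Fin n) ℤ,
      InGKM h F ∧ (∀ w, (F w).IsHomogeneous 1) ∧ ∀ w ∈ component h r σ, F w = f w := by
  have hg : GK h r σ (fun w x => lc (f w) x) := by
    have key : ∀ w, Reach (E h r) σ w → ∀ i j, E h r i j → j < i → i ≤ h j →
        EC (fun w x => lc (f w) x) w i j := by
      intro w hw i j hE hji hij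
      have H := hf w ((mem_component_iff hσ w).mpr hw) i j hji hij
        ((mem_component_iff hσ _).mpr (reach_step hw hE))
      have H2 := lc_of_mem (by simpa using hji.ne') H
      have e : ∀ x, lc (f w - f (w * swap i j)) x = lc (f w) x - lc (f (w * swap i j)) x :=
        fun x => coeff_sub _ _ _ _
      simp only [e] at H2
      refine ⟨fun x h1 h2 => ?_, ?_⟩
      · have := H2.1 x h1 h2
        dsimp only; omega
      · have := H2.2
        dsimp only; omega
    intro w hw i j hE
    rcases hE.2.2 with c | c
    · exact key w hw i j hE c.1 c.2
    · exact (key w hw j i hE.symm c.1 c.2).symm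
  obtain ⟨G, hG, hGe⟩ := vec_main hmono hlol hg
  refine ⟨fun w => lf (G w), fun w i j hji hij => ?_, fun w => lf_hom _, fun w hw => ?_⟩
  · have H := hG w i j hji hij
    exact lf_mem (by simpa using hji.ne') H.1 H.2
  · refine hom_ext (lf_hom _) (hdeg w hw) fun x => ?_
    rw [lc_lf, hGe w ((mem_component_iff hσ w).mp hw)]

end convert

end LolProof

/-- let `h` be of lollipop form, `r ∈ [n]`, and let `C` be the connected
component of `Γ(S_n^r, h)` containing `σ ∈ S_n^r`.  Then every degree-2 element of the
graph cohomology of `C` (a function on the vertices of `C` satisfying the GKM condition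
along the edges of `C`, with all values homogeneous of degree `1` or zero) is the
restriction to `C` of a degree-2 element of `H(h)`. -/
theorem degree_two_restriction_surjective (n : ℕ) (h : Fin n → Fin n)
    (hmono : Monotone h) (hhess : ∀ j, j ≤ h j) (hlol : Lollipop h)
    (r : Fin n) (σ : Equiv.Perm (Fin n)) (hσ : (σ r : ℕ) = n - 1)
    (f : Equiv.Perm (Fin n) → MvPolynomial (Fin n) ℤ)
    (hf : ∀ w ∈ component h r σ, ∀ i j : Fin n, j < i → i ≤ h j →
      w * Equiv.swap i j ∈ component h r σ →
      f w - f (w * Equiv.swap i j) ∈ Ideal.span {X (w i) - X (w j)})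
    (hdeg : ∀ w ∈ component h r σ, (f w).IsHomogeneous 1) :
    ∃ F : Equiv.Perm (Fin n) → MvPolynomial (Fin n) ℤ,
      InGKM h F ∧ (∀ w, (F w).IsHomogeneous 1) ∧ ∀ w ∈ component h r σ, F w = f w := by
  exact LolProof.main_aux hmono hlol hσ f hf hdeg
end
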